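/- arXiv:0911.4196 — 2 statements merged into one kernel-verified Lean document; each statement's English description precedes it below -/
import Mathlib

section
/- Suppose dim T ≥ 1 and every associated prime P of the T-module T/pT satisfies P ⊆ ⋃_{i=1}^k Qᵢ. Let (R, R ∩ 𝔪) be a pca subring of T such that pT ∩ R = pR, let J be an ideal of T with J ⊄ Qᵢ for all i ∈ {1, …, k}, and let u + J ∈ T/J. Then there exists a pca subring S of T such that: (1) R ⊆ S ⊆ T; (2) Γ(S) = Γ(R); (3) u + J is in the image of the canonical map S → T/J; (4) if u ∈ J, then S ∩ J ⊄ Qᵢ for each i ∈ {1, …, k}; and (5) for every finitely generated ideal I of S, IT ∩ S = I. -/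
universe u

/-- `Γ(X) = max(|X|, ℵ₀)`. -/
noncomputable def Gamma (X : Type u) : Cardinal.{u} :=
  max (Cardinal.mk X) Cardinal.aleph0

/-- The set `(Q \ pT)R = {t ∈ T | t = qr for some q ∈ Q \ pT, r ∈ R}`. -/
def CompAvoid {T : Type u} [CommRing T] (Q : Ideal T) (p : T) (R : Set T) : Set T :=
  {t : T | ∃ q ∈ Q, q ∉ Ideal.span {p} ∧ ∃ r ∈ R, t = q * r}

/-- `R` is quasilocal with maximal ideal `R ∩ 𝔪`: every element of `R` outside the
maximal ideal of `T` is a unit of `R`. -/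
def QuasilocalWithMaxIdeal {T : Type u} [CommRing T] [IsLocalRing T] (R : Subring T) : Prop :=
  ∀ x : R, (x : T) ∉ IsLocalRing.maximalIdeal T → IsUnit x

/-- `R` is a `p`ca (`pT`-complement avoiding) subring of `T`:
`(R, R ∩ 𝔪)` is quasilocal, `p ∈ R`, `Γ(R) < |T|`, `R ∩ P = (0)` for every associated
prime `P` of `T`, and `((Qᵢ \ pT)R) ∩ R = {0}` for all `i`. -/
def IsPcaSubring {T : Type u} [CommRing T] [IsLocalRing T] {k : ℕ}
    (Q : Fin k → Ideal T) (p : T) (R : Subring T) : Prop :=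
  p ∈ R ∧ QuasilocalWithMaxIdeal R ∧
  Gamma ↥R < Cardinal.mk T ∧
  (∀ P ∈ associatedPrimes T T, ∀ x ∈ R, x ∈ P → x = 0) ∧
  (∀ i : Fin k, ∀ t ∈ CompAvoid (Q i) p (R : Set T), t ∈ R → t = 0)

section

open Cardinal IsLocalRing

theorem mk_quotient_maximalIdeal_pow_le {T : Type u} [CommRing T] [IsLocalRing T]
    [IsNoetherianRing T] (n : ℕ) :
    #(T ⧸ maximalIdeal T ^ n) ≤ max #(ResidueField T) ℵ₀ := by
  induction n with
  | zero =>
    have : Subsingleton (T ⧸ maximalIdeal T ^ 0) := by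
      rw [pow_zero, Ideal.one_eq_top]
      exact Ideal.Quotient.subsingleton_iff.mpr rfl
    exact (le_one_iff_subsingleton.mpr this).trans (one_le_aleph0.trans (le_max_right _ _))
  | succ n ih =>
    obtain ⟨d, s, hs⟩ := Submodule.fg_iff_exists_fin_generating_family.mp
      (IsNoetherian.noetherian (maximalIdeal T ^ n))
    let σ : ResidueField T → T := Function.surjInv (residue_surjective (R := T))
    have hσ : ∀ c : T, c - σ (residue T c) ∈ maximalIdeal T := fun c => by
      rw [← residue_eq_zero_iff, map_sub,
        Function.surjInv_eq (residue_surjective (R := T)), sub_self]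
    let F : (T ⧸ maximalIdeal T ^ n) × (Fin d → ResidueField T) → T ⧸ maximalIdeal T ^ (n + 1) :=
      fun a => Ideal.Quotient.mk _ (Quotient.out a.1 + ∑ i, σ (a.2 i) * s i)
    have hF : Function.Surjective F := fun t => by
      obtain ⟨t, rfl⟩ := Ideal.Quotient.mk_surjective t
      have h1 : t - Quotient.out (Ideal.Quotient.mk (maximalIdeal T ^ n) t) ∈
          Ideal.span (Set.range s) := by
        rw [show Ideal.span (Set.range s) = maximalIdeal T ^ n from hs, ← Ideal.Quotient.eq]
        exact (Ideal.Quotient.mk_out _).symm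
      obtain ⟨c, hc⟩ := Ideal.mem_span_range_iff_exists_fun.mp h1
      refine ⟨(Ideal.Quotient.mk _ t, fun i => residue T (c i)), ?_⟩
      refine (Ideal.Quotient.eq.mpr ?_).symm
      have : t - (Quotient.out (Ideal.Quotient.mk (maximalIdeal T ^ n) t) +
          ∑ i, σ (residue T (c i)) * s i) = ∑ i, (c i - σ (residue T (c i))) * s i := by
        simp only [sub_mul, Finset.sum_sub_distrib, hc]
        ring
      rw [this, pow_succ']
      refine Ideal.sum_mem _ fun i _ => Ideal.mul_mem_mul (hσ _) ?_
      rw [← hs]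
      exact Submodule.subset_span ⟨i, rfl⟩
    refine (mk_le_of_surjective hF).trans ?_
    rw [mk_prod, lift_id, lift_id]
    refine mul_le_of_le (le_max_right _ _) ih ?_
    rw [mk_arrow]
    simpa using power_nat_le_max (c := #(ResidueField T)) (n := d)

/-- A Noetherian local ring is no larger than the set of sequences in its residue field. -/
theorem mk_le_mk_nat_arrow_residueField (T : Type u) [CommRing T] [IsLocalRing T]
    [IsNoetherianRing T] : #T ≤ #(ℕ → ResidueField T) := by
  have hk : max #(ResidueField T) ℵ₀ ≤ #(ℕ → ResidueField T) := by
    have h2 : (2 : Cardinal) ≤ #(ResidueField T) := by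
      rw [two_le_iff]
      exact ⟨0, 1, zero_ne_one⟩
    rw [mk_arrow, lift_uzero, mk_nat, lift_aleph0]
    refine max_le (self_le_power _ one_le_aleph0) ?_
    exact (cantor ℵ₀).le.trans (power_le_power_right h2)
  have he (n : ℕ) : Nonempty ((T ⧸ maximalIdeal T ^ n) ↪ (ℕ → ResidueField T)) :=
    (mk_quotient_maximalIdeal_pow_le n).trans hk
  let e (n : ℕ) := (he n).some
  let E : T → ℕ → ℕ → ResidueField T := fun t n => e n (Ideal.Quotient.mk _ t)
  have hE : Function.Injective E := fun a b hab => by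
    rw [← sub_eq_zero, ← Ideal.mem_bot, ← Ideal.iInf_pow_eq_bot_of_isLocalRing (maximalIdeal T)
      (maximalIdeal.isMaximal T).ne_top, Ideal.mem_iInf]
    exact fun n => Ideal.Quotient.eq.mp ((e n).injective (congrFun hab n))
  refine (mk_le_of_injective hE).trans (le_of_eq ?_)
  exact mk_congr ((Equiv.curry ℕ ℕ (ResidueField T)).symm.trans
    (Equiv.arrowCongr Nat.pairEquiv (Equiv.refl _)))

/-- In a complete local ring, evaluating power series whose coefficients are representatives of
the residue field at an element `y` of the maximal ideal gives a family indexed by sequences in the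
residue field that is injective modulo every prime not containing `y`. -/
theorem exists_forall_sub_mem_imp_eq {T : Type u} [CommRing T] [IsLocalRing T]
    [IsAdicComplete (maximalIdeal T) T] {y : T} (hy : y ∈ maximalIdeal T) :
    ∃ L : (ℕ → ResidueField T) → T, ∀ P : Ideal T, P.IsPrime → y ∉ P →
      ∀ a b, L a - L b ∈ P → a = b := by
  let σ : ResidueField T → T := Function.surjInv (residue_surjective (R := T))
  have hσ : ∀ c, residue T (σ c) = c := Function.surjInv_eq _
  have hpow (n : ℕ) : (maximalIdeal T ^ n • ⊤ : Submodule T T) = maximalIdeal T ^ n := by simp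
  have hL (a : ℕ → ResidueField T) : ∃ L : T, ∀ n,
      ∑ i ∈ Finset.range n, σ (a i) * y ^ i - L ∈ maximalIdeal T ^ n := by
    obtain ⟨L, h⟩ := IsPrecomplete.prec (I := maximalIdeal T) (M := T) inferInstance
      (f := fun n => ∑ i ∈ Finset.range n, σ (a i) * y ^ i) (fun {m n} hmn => by
        rw [hpow]
        symm
        rw [SModEq.sub_mem, ← Finset.sum_range_add_sum_Ico _ hmn, add_sub_cancel_left]
        refine Ideal.sum_mem _ fun i hi => Ideal.mul_mem_left _ _ ?_
        exact Ideal.pow_le_pow_right (Finset.mem_Ico.mp hi).1 (Ideal.pow_mem_pow hy i))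
    refine ⟨L, fun n => ?_⟩
    have := h n
    rwa [hpow, SModEq.sub_mem] at this
  choose L hL using hL
  have hrec (a : ℕ → ResidueField T) : L a = σ (a 0) + y * L fun n => a (n + 1) := by
    rw [← sub_eq_zero]
    refine IsHausdorff.haus (I := maximalIdeal T) inferInstance _ fun n => ?_
    rw [hpow, SModEq.sub_mem, sub_zero]
    have h1 := Ideal.pow_le_pow_right (Nat.le_succ n) (hL a (n + 1))
    have h2 := Ideal.mul_mem_left _ y (hL (fun n => a (n + 1)) n)
    rw [Finset.sum_range_succ'] at h1
    have h3 : ∑ i ∈ Finset.range n, σ (a (i + 1)) * y ^ (i + 1) =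
        y * ∑ i ∈ Finset.range n, σ (a (i + 1)) * y ^ i := by
      rw [Finset.mul_sum]
      exact Finset.sum_congr rfl fun i _ => by ring
    rw [h3] at h1
    convert sub_mem h2 h1 using 1
    ring
  refine ⟨L, fun P hP hyP a b hab => ?_⟩
  have h0 (a b) (hab : L a - L b ∈ P) : a 0 = b 0 := by
    by_contra hne
    have hu : IsUnit (L a - L b) := by
      rw [← residue_ne_zero_iff_isUnit, hrec a, hrec b]
      have hy0 : residue T y = 0 := (residue_eq_zero_iff _).mpr hy
      simpa [hy0, hσ, sub_eq_zero] using hne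
    exact hP.ne_top (Ideal.eq_top_of_isUnit_mem _ hab hu)
  have key (n : ℕ) : ∀ a b, L a - L b ∈ P → a n = b n := by
    induction n with
    | zero => exact h0
    | succ n ih =>
      intro a b hab
      refine ih (fun n => a (n + 1)) (fun n => b (n + 1)) ?_
      have : y * (L (fun n => a (n + 1)) - L fun n => b (n + 1)) ∈ P := by
        have h1 := h0 a b hab
        rw [hrec a, hrec b, h1] at hab
        convert hab using 1
        ring
      exact (hP.mem_or_mem this).resolve_left hyP
  exact funext fun n => key n a b hab

/-- A subring `S` of cardinality at most `κ` satisfying the pca conditions and equal to the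
intersection of `T` with its fraction field; in particular it is quasilocal. -/
structure IsFractionClosedPca {T : Type u} [CommRing T] {ι : Type*} (Q : ι → Ideal T) (p : T)
    (κ : Cardinal.{u}) (S : Subring T) : Prop where
  p_mem : p ∈ S
  card_le : #S ≤ κ
  regular : ∀ x ∈ S, x ≠ 0 → x ∈ nonZeroDivisors T
  avoid : ∀ i, ∀ q ∈ Q i, ∀ r ∈ S, q * r ∈ S → q * r ≠ 0 → p ∣ q
  closed : ∀ b ∈ S, b ≠ 0 → ∀ t, b * t ∈ S → t ∈ S

/-- The elements of `T` that are fractions with numerator in `S` and denominator a regular element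
of `S`. -/
def fractionClosure {T : Type u} [CommRing T] (S : Subring T) : Subring T where
  carrier := {t | ∃ b ∈ S, b ∈ nonZeroDivisors T ∧ b * t ∈ S}
  one_mem' := ⟨1, S.one_mem, Submonoid.one_mem _, by simp⟩
  zero_mem' := ⟨1, S.one_mem, Submonoid.one_mem _, by simp⟩
  mul_mem' := by
    rintro s t ⟨b, hb, hb', hbs⟩ ⟨c, hc, hc', hct⟩
    refine ⟨b * c, S.mul_mem hb hc, mul_mem hb' hc', ?_⟩
    rw [mul_mul_mul_comm]
    exact S.mul_mem hbs hct
  add_mem' := by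
    rintro s t ⟨b, hb, hb', hbs⟩ ⟨c, hc, hc', hct⟩
    refine ⟨b * c, S.mul_mem hb hc, mul_mem hb' hc', ?_⟩
    rw [show b * c * (s + t) = c * (b * s) + b * (c * t) by ring]
    exact S.add_mem (S.mul_mem hc hbs) (S.mul_mem hb hct)
  neg_mem' := by
    rintro s ⟨b, hb, hb', hbs⟩
    exact ⟨b, hb, hb', by rw [mul_neg]; exact S.neg_mem hbs⟩

theorem le_fractionClosure {T : Type u} [CommRing T] (S : Subring T) : S ≤ fractionClosure S :=
  fun t ht => ⟨1, S.one_mem, Submonoid.one_mem _, by simpa using ht⟩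

theorem isFractionClosedPca_fractionClosure {T : Type u} [CommRing T] [Nontrivial T] {ι : Type*}
    {Q : ι → Ideal T} {p : T} {κ : Cardinal.{u}} (hκ : ℵ₀ ≤ κ) {S : Subring T} (hp : p ∈ S)
    (hcard : #S ≤ κ) (hreg : ∀ x ∈ S, x ≠ 0 → x ∈ nonZeroDivisors T)
    (havoid : ∀ i, ∀ q ∈ Q i, ∀ r ∈ S, q * r ∈ S → q * r ≠ 0 → p ∣ q) :
    IsFractionClosedPca Q p κ (fractionClosure S) where
  p_mem := le_fractionClosure S hp
  card_le := by
    choose b hb hb' hbt using fun t : fractionClosure S => t.2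
    have hinj : Function.Injective
        fun t => ((⟨b t, hb t⟩, ⟨b t * t, hbt t⟩) : S × S) := by
      intro s t hst
      simp only [Prod.mk.injEq, Subtype.mk.injEq] at hst
      obtain ⟨h1, h2⟩ := hst
      rw [h1] at h2
      exact Subtype.ext ((mul_cancel_left_mem_nonZeroDivisors (hb' t)).mp h2)
    refine (mk_le_of_injective hinj).trans ?_
    rw [mk_prod, lift_id]
    exact mul_le_of_le hκ hcard hcard
  regular := by
    rintro x ⟨b, hb, hb', hbx⟩ hx
    have h := hreg _ hbx fun h =>
      hx ((mul_left_mem_nonZeroDivisors_eq_zero_iff hb').mp h)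
    exact (mul_mem_nonZeroDivisors.mp h).2
  avoid := by
    rintro i q hq r ⟨b, hb, hb', hbr⟩ ⟨c, hc, hc', hcr⟩ h0
    refine havoid i q hq (c * (b * r)) (S.mul_mem hc hbr) ?_ ?_
    · rw [show q * (c * (b * r)) = b * (c * (q * r)) by ring]
      exact S.mul_mem hb hcr
    · rw [show q * (c * (b * r)) = b * c * (q * r) by ring]
      exact fun h => h0 ((mul_left_mem_nonZeroDivisors_eq_zero_iff (mul_mem hb' hc')).mp h)
  closed := by
    rintro b ⟨c, hc, hc', hcb⟩ hb0 t ⟨d, hd, hd', hdt⟩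
    have hcb' : c * b ∈ nonZeroDivisors T :=
      hreg _ hcb fun h => hb0 ((mul_left_mem_nonZeroDivisors_eq_zero_iff hc').mp h)
    refine ⟨c * b * d, S.mul_mem hcb hd, mul_mem hcb' hd', ?_⟩
    rw [show c * b * d * t = c * (d * (b * t)) by ring]
    exact S.mul_mem hc hdt

theorem IsFractionClosedPca.dvd_of_mem {T : Type u} [CommRing T] {ι : Type*}
    {Q : ι → Ideal T} {p : T} {κ : Cardinal.{u}} {S : Subring T}
    (hS : IsFractionClosedPca Q p κ S) {i : ι} {x : T} (hx : x ∈ S) (hxQ : x ∈ Q i) : p ∣ x := by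
  by_cases h0 : x = 0
  · exact h0 ▸ dvd_zero p
  · exact hS.avoid i x hxQ 1 S.one_mem (by simpa using hx) (by simpa using h0)

open Polynomial in
/-- Adjoining an element that is transcendental modulo every `Q i` preserves the pca conditions. -/
theorem IsFractionClosedPca.adjoin {T : Type u} [CommRing T] [Nontrivial T] {ι : Type*}
    {Q : ι → Ideal T} {p : T} {κ : Cardinal.{u}} (hκ : ℵ₀ ≤ κ)
    (hpreg : p ∈ nonZeroDivisors T)
    (hsep : ∀ t, (∀ n, p ^ n ∣ t) → t = 0)
    (hdvd : ∀ v, (∀ i, v ∉ Q i) → ∀ t, p ∣ v * t → p ∣ t) {S : Subring T}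
    (hS : IsFractionClosedPca Q p κ S) {x : T}
    (hx : ∀ i (f : S[X]), f.eval₂ S.subtype x ∈ Q i → ∀ n, (f.coeff n : T) ∈ Q i) :
    IsFractionClosedPca Q p κ (fractionClosure (eval₂RingHom S.subtype x).range) := by
  have hppow (n : ℕ) : p ^ n ∈ nonZeroDivisors T := pow_mem hpreg n
  have hSdvd {m : ℕ} {c : S} (h : p ^ m ∣ (c : T)) : (⟨p, hS.p_mem⟩ : S) ^ m ∣ c := by
    obtain ⟨t, ht⟩ := h
    have hpm : p ^ m ∈ S := pow_mem hS.p_mem m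
    exact ⟨⟨t, hS.closed _ hpm (nonZeroDivisors.ne_zero (hppow m)) t (ht ▸ c.2)⟩, Subtype.ext ht⟩
  have hfactor (f : S[X]) (hf : f ≠ 0) :
      ∃ m g, f.eval₂ S.subtype x = p ^ m * g ∧ ∀ i, g ∉ Q i := by
    have hfin : FiniteMultiplicity (C ⟨p, hS.p_mem⟩) f := by
      by_contra hinf
      rw [FiniteMultiplicity.not_iff_forall] at hinf
      refine hf (Polynomial.ext fun n => Subtype.ext (hsep _ fun m => ?_))
      have h := hinf m
      rw [← C_pow, C_dvd_iff_dvd_coeff] at h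
      simpa using map_dvd S.subtype (h n)
    obtain ⟨g, hg, hgdvd⟩ := hfin.exists_eq_pow_mul_and_not_dvd
    refine ⟨multiplicity (C ⟨p, hS.p_mem⟩) f, g.eval₂ S.subtype x, ?_, fun i hi => hgdvd ?_⟩
    · conv_lhs => rw [hg]
      simp [eval₂_mul, eval₂_pow]
    · rw [C_dvd_iff_dvd_coeff]
      intro n
      have := hSdvd (m := 1) (c := g.coeff n)
        (by simpa using hS.dvd_of_mem (g.coeff n).2 (hx i g hi n))
      simpa using this
  have hregular (v : T) (hv : ∀ i, v ∉ Q i) : v ∈ nonZeroDivisors T := by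
    refine mem_nonZeroDivisors_iff_right.mpr fun t ht => hsep t fun n => ?_
    rw [mul_comm] at ht
    have key (n : ℕ) : ∀ t, v * t = 0 → p ^ n ∣ t := by
      induction n with
      | zero => simp
      | succ n ih =>
        intro t ht
        obtain ⟨s, rfl⟩ := hdvd v hv t (ht ▸ dvd_zero p)
        rw [pow_succ']
        refine mul_dvd_mul_left p (ih s ?_)
        rw [mul_left_comm] at ht
        exact (mul_left_mem_nonZeroDivisors_eq_zero_iff hpreg).mp ht
    exact key n t ht
  refine isFractionClosedPca_fractionClosure hκ ⟨C ⟨p, hS.p_mem⟩, by simp⟩ ?_ ?_ ?_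
  · refine (mk_le_of_surjective (eval₂RingHom S.subtype x).rangeRestrict_surjective).trans ?_
    exact cardinalMk_le_max.trans (max_le hS.card_le hκ)
  · rintro _ ⟨f, rfl⟩ hf
    rw [coe_eval₂RingHom] at hf ⊢
    obtain ⟨m, g, hg, hgQ⟩ := hfactor f fun h => hf (by simp [h])
    rw [hg]
    exact mul_mem (hppow m) (hregular g hgQ)
  · rintro i q hq _ ⟨G, rfl⟩ ⟨F, hF⟩ h0
    rw [coe_eval₂RingHom] at hF h0
    obtain ⟨m, g, hg, hgQ⟩ := hfactor G fun h => h0 (by simp [h])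
    obtain ⟨l, f, hf, hfQ⟩ := hfactor F fun h => h0 (by rw [← hF, h, eval₂_zero])
    rw [hg, hf] at hF
    rcases le_or_gt l m with hlm | hlm
    · obtain ⟨d, rfl⟩ := Nat.exists_eq_add_of_le hlm
      refine absurd ?_ (hfQ i)
      have : f = q * (p ^ d * g) :=
        (mul_cancel_left_mem_nonZeroDivisors (hppow l)).mp (by rw [hF, pow_add]; ring)
      exact this ▸ Ideal.mul_mem_right _ _ hq
    · obtain ⟨d, rfl⟩ := Nat.exists_eq_add_of_lt hlm
      refine hdvd g hgQ q ⟨p ^ d * f, ?_⟩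
      exact (mul_cancel_left_mem_nonZeroDivisors (hppow m)).mp
        (by rw [mul_comm g q, mul_left_comm, ← hF]; ring)

open Polynomial in
theorem exists_sub_mem_forall_coeff_mem {T : Type u} [CommRing T] [IsLocalRing T]
    [IsNoetherianRing T] [IsAdicComplete (maximalIdeal T) T] {ι : Type*} [Finite ι]
    {Q : ι → Ideal T} (hQ : ∀ i, (Q i).IsPrime) (hQm : ∀ i, Q i ≠ maximalIdeal T)
    {κ : Cardinal.{u}} (hκ : ℵ₀ ≤ κ) (hκT : κ < #T) {S : Subring T} (hS : #S ≤ κ)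
    {J : Ideal T} (hJ : ∀ i, ¬ J ≤ Q i) (u : T) :
    ∃ x, x - u ∈ J ∧
      ∀ i (f : S[X]), f.eval₂ S.subtype x ∈ Q i → ∀ n, (f.coeff n : T) ∈ Q i := by
  have havoid (I : Ideal T) (hI : ∀ i, ¬ I ≤ Q i) : ∃ z ∈ I, ∀ i, z ∉ Q i := by
    classical
    have := Fintype.ofFinite ι
    by_contra! h
    rcases isEmpty_or_nonempty ι with hι | ⟨⟨i₀⟩⟩
    · exact (h 0 I.zero_mem).elim fun i _ => hι.elim i
    obtain ⟨i, -, hi⟩ := (Ideal.subset_union_prime (s := Finset.univ) (f := Q) i₀ i₀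
      (fun i _ _ _ => hQ i) (I := I)).mp fun z hz => by simpa using h z hz
    exact hI i hi
  obtain ⟨y, hym, hyQ⟩ := havoid (maximalIdeal T) fun i hi =>
    hQm i (le_antisymm (le_maximalIdeal (hQ i).ne_top) hi)
  obtain ⟨j, hjJ, hjQ⟩ := havoid J hJ
  obtain ⟨L, hL⟩ := exists_forall_sub_mem_imp_eq hym
  by_contra! hbad
  let B (f : S[X]) : Set (ℕ → ResidueField T) :=
    {a | ∃ i, f.eval₂ S.subtype (u + j * L a) ∈ Q i ∧ ∃ n, (f.coeff n : T) ∉ Q i}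
  have hB (f : S[X]) : (B f).Finite := by
    have : B f = ⋃ i, {a | f.eval₂ S.subtype (u + j * L a) ∈ Q i ∧
        ∃ n, (f.coeff n : T) ∉ Q i} := by
      ext a
      simp [B]
    rw [this]
    refine Set.finite_iUnion fun i => ?_
    by_cases hn : ∃ n, (f.coeff n : T) ∉ Q i
    swap
    · simp [hn]
    obtain ⟨n, hn⟩ := hn
    have := hQ i
    let φ : S →+* T ⧸ Q i := (Ideal.Quotient.mk (Q i)).comp S.subtype
    have hg : f.map φ ≠ 0 := fun h => hn <| by
      have := congrArg (coeff · n) h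
      simpa [φ, Ideal.Quotient.eq_zero_iff_mem] using this
    refine Set.Finite.of_injOn (f := fun a => Ideal.Quotient.mk (Q i) (u + j * L a))
      (t := {z | (f.map φ).IsRoot z}) ?_ ?_ (finite_setOfPred_isRoot hg)
    · rintro a ⟨ha, -⟩
      rw [Set.mem_ofPred_eq, IsRoot.def, eval_map, ← hom_eval₂]
      exact Ideal.Quotient.eq_zero_iff_mem.mpr ha
    · intro a _ b _ hab
      have h := Ideal.Quotient.eq.mp hab
      rw [add_sub_add_left_eq_sub, ← mul_sub] at h
      exact hL (Q i) (hQ i) (hyQ i) a b (((hQ i).mem_or_mem h).resolve_left (hjQ i))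
  have hcov : (⋃ f, B f) = Set.univ := by
    refine Set.eq_univ_of_forall fun a => ?_
    obtain ⟨i, f, hf, n, hn⟩ := hbad (u + j * L a)
      (by simpa using Ideal.mul_mem_right _ _ hjJ)
    exact Set.mem_iUnion.mpr ⟨f, i, hf, n, hn⟩
  refine (hκT.trans_le (mk_le_mk_nat_arrow_residueField T)).not_ge ?_
  rw [← mk_univ, ← hcov]
  refine (mk_iUnion_le B).trans (mul_le_of_le hκ ?_ ?_)
  · exact cardinalMk_le_max.trans (max_le hS hκ)
  · exact (ciSup_le' fun f => (hB f).lt_aleph0.le).trans hκ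

theorem isFractionClosedPca_sSup {T : Type u} [CommRing T] {ι : Type*} {Q : ι → Ideal T} {p : T}
    {κ : Cardinal.{u}} (hκ : ℵ₀ ≤ κ) {A : Set (Subring T)} (hne : A.Nonempty)
    (hdir : DirectedOn (· ≤ ·) A) (hcard : #A ≤ κ) (hA : ∀ S ∈ A, IsFractionClosedPca Q p κ S) :
    IsFractionClosedPca Q p κ (sSup A) := by
  have hmem {x : T} : x ∈ sSup A ↔ ∃ S ∈ A, x ∈ S := Subring.mem_sSup_of_directedOn hne hdir
  have hmem₂ {x y : T} (hx : x ∈ sSup A) (hy : y ∈ sSup A) : ∃ S ∈ A, x ∈ S ∧ y ∈ S := by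
    obtain ⟨S, hS, hxS⟩ := hmem.mp hx
    obtain ⟨S', hS', hyS'⟩ := hmem.mp hy
    obtain ⟨U, hU, h, h'⟩ := hdir S hS S' hS'
    exact ⟨U, hU, h hxS, h' hyS'⟩
  refine ⟨?_, ?_, ?_, ?_, ?_⟩
  · obtain ⟨S, hS⟩ := hne
    exact hmem.mpr ⟨S, hS, (hA S hS).p_mem⟩
  · have h : #(↑(sSup A) : Set T) ≤ κ := by
      rw [Subring.coe_sSup_of_directedOn hne hdir]
      exact (mk_biUnion_le _ _).trans
        (mul_le_of_le hκ hcard (ciSup_le' fun S => (hA S S.2).card_le))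
    exact h
  · intro x hx
    obtain ⟨S, hS, hxS⟩ := hmem.mp hx
    exact (hA S hS).regular x hxS
  · intro i q hq r hr hqr
    obtain ⟨S, hS, hrS, hqrS⟩ := hmem₂ hr hqr
    exact (hA S hS).avoid i q hq r hrS hqrS
  · intro b hb hb0 t hbt
    obtain ⟨S, hS, hbS, hbtS⟩ := hmem₂ hb hbt
    exact hmem.mpr ⟨S, hS, (hA S hS).closed b hbS hb0 t hbtS⟩

/-- If every element of a family of at most `κ` monotone conditions on subrings can be achieved by
passing to a larger good subring, then all of them can be achieved simultaneously. -/
theorem exists_ge_forall_of_forall_exists_ge {T : Type u} [CommRing T] {κ : Cardinal.{u}}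
    (hκ : ℵ₀ ≤ κ) {Good : Subring T → Prop}
    (hsup : ∀ A : Set (Subring T), A.Nonempty → DirectedOn (· ≤ ·) A → #A ≤ κ →
      (∀ S ∈ A, Good S) → Good (sSup A))
    {Ω : Type u} (hΩ : #Ω ≤ κ) {Solved : Ω → Subring T → Prop}
    (hmono : ∀ ω, Monotone (Solved ω)) {R : Subring T} (hR : Good R)
    (hstep : ∀ ω S, R ≤ S → Good S → ∃ S', S ≤ S' ∧ Good S' ∧ Solved ω S') :
    ∃ S, R ≤ S ∧ Good S ∧ ∀ ω, Solved ω S := by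
  have hstep' (ω : Ω) (S : Subring T) :
      ∃ S', S ≤ S' ∧ (R ≤ S → Good S → Good S' ∧ Solved ω S') := by
    by_cases h : R ≤ S ∧ Good S
    · obtain ⟨S', h1, h2⟩ := hstep ω S h.1 h.2
      exact ⟨S', h1, fun _ _ => h2⟩
    · exact ⟨S, le_rfl, fun h1 h2 => (h ⟨h1, h2⟩).elim⟩
  choose next hle hnext using hstep'
  let r : Ω → Ω → Prop := WellOrderingRel
  have hwf : WellFounded r := WellOrderingRel.isWellOrder.wf
  let F : Ω → Subring T := hwf.fix fun α ih =>
    next α (sSup (insert R (Set.range fun β : {β // r β α} => ih β.1 β.2)))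
  have hF (α : Ω) : F α = next α (sSup (insert R (F '' {β | r β α}))) := by
    rw [Set.image_eq_range]
    exact hwf.fix_eq _ α
  have hRF (α : Ω) : R ≤ F α := by
    rw [hF]
    exact (le_sSup (Set.mem_insert _ _)).trans (hle _ _)
  have hFmono {α β : Ω} (h : r β α) : F β ≤ F α := by
    rw [hF α]
    exact (le_sSup (Set.mem_insert_of_mem _ (Set.mem_image_of_mem F h))).trans (hle _ _)
  have hdir (s : Set Ω) : DirectedOn (· ≤ ·) (insert R (F '' s)) := by
    rintro _ (rfl | ⟨α, hα, rfl⟩) _ (rfl | ⟨β, hβ, rfl⟩)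
    · exact ⟨_, Set.mem_insert _ _, le_rfl, le_rfl⟩
    · exact ⟨_, Set.mem_insert_of_mem _ ⟨β, hβ, rfl⟩, hRF β, le_rfl⟩
    · exact ⟨_, Set.mem_insert_of_mem _ ⟨α, hα, rfl⟩, le_rfl, hRF α⟩
    · rcases trichotomous_of r α β with h | rfl | h
      · exact ⟨_, Set.mem_insert_of_mem _ ⟨β, hβ, rfl⟩, hFmono h, le_rfl⟩
      · exact ⟨_, Set.mem_insert_of_mem _ ⟨α, hα, rfl⟩, le_rfl, le_rfl⟩
      · exact ⟨_, Set.mem_insert_of_mem _ ⟨α, hα, rfl⟩, le_rfl, hFmono h⟩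
  have hsup' (s : Set Ω) (hs : ∀ α ∈ s, Good (F α)) : Good (sSup (insert R (F '' s))) := by
    refine hsup _ (Set.insert_nonempty _ _) (hdir s) ?_ ?_
    · refine mk_insert_le.trans (add_le_of_le hκ ?_ (one_le_aleph0.trans hκ))
      exact mk_image_le.trans ((mk_set_le s).trans hΩ)
    · rintro _ (rfl | ⟨α, hα, rfl⟩)
      exacts [hR, hs α hα]
  have hgood (α : Ω) : Good (F α) ∧ Solved α (F α) := by
    induction α using hwf.induction with
    | h α ih =>
      rw [hF]
      exact hnext _ _ (le_sSup (Set.mem_insert _ _)) (hsup' _ fun β hβ => (ih β hβ).1)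
  refine ⟨sSup (insert R (F '' Set.univ)), le_sSup (Set.mem_insert _ _),
    hsup' _ fun α _ => (hgood α).1, fun ω => hmono ω (le_sSup ?_) (hgood ω).2⟩
  exact Set.mem_insert_of_mem _ ⟨ω, trivial, rfl⟩

/-- A linear relation with coefficients in `S` can be realized over a larger subring. -/
theorem IsFractionClosedPca.exists_sum_eq {T : Type u} [CommRing T] {ι : Type*}
    {Q : ι → Ideal T} {p : T} {κ : Cardinal.{u}} (hp0 : p ≠ 0) (hsep : ∀ t, (∀ n, p ^ n ∣ t) → t = 0)
    (hstep : ∀ S, IsFractionClosedPca Q p κ S → ∀ J : Ideal T, (∀ i, ¬ J ≤ Q i) → ∀ u,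
      ∃ S', S ≤ S' ∧ IsFractionClosedPca Q p κ S' ∧ ∃ x ∈ S', x - u ∈ J)
    {S : Subring T} (hS : IsFractionClosedPca Q p κ S) {σ : Type*} (s : Finset σ)
    (a : σ → T) (ha : ∀ i, a i ∈ S) (c : T) (hc : c ∈ S) (t : σ → T)
    (hct : c = ∑ i ∈ s, t i * a i) :
    ∃ S', S ≤ S' ∧ IsFractionClosedPca Q p κ S' ∧
      ∃ g : σ → T, (∀ i, g i ∈ S') ∧ c = ∑ i ∈ s, g i * a i := by
  classical
  by_cases h0 : ∀ i ∈ s, a i = 0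
  · refine ⟨S, le_rfl, hS, 0, fun _ => S.zero_mem, ?_⟩
    rw [hct, Finset.sum_congr rfl fun i hi => by rw [h0 i hi, mul_zero]]
    simp
  have hlift (W : Finset σ) (J : Ideal T) (hJ : ∀ i, ¬ J ≤ Q i) :
      ∃ S', S ≤ S' ∧ IsFractionClosedPca Q p κ S' ∧ ∀ i ∈ W, ∃ x ∈ S', x - t i ∈ J := by
    induction W using Finset.induction_on with
    | empty => exact ⟨S, le_rfl, hS, by simp⟩
    | insert i W _ ih =>
      obtain ⟨S₁, h1, h2, h3⟩ := ih
      obtain ⟨S₂, h4, h5, h6⟩ := hstep S₁ h2 J hJ (t i)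
      refine ⟨S₂, h1.trans h4, h5, fun j hj => ?_⟩
      rcases Finset.mem_insert.mp hj with rfl | hj
      · exact h6
      · obtain ⟨x, hx, hxJ⟩ := h3 j hj
        exact ⟨x, h4 hx, hxJ⟩
  have key (m : ℕ) : ∀ (a : σ → T) (c : T), (∀ i, a i ∈ S) → c ∈ S → c = ∑ i ∈ s, t i * a i →
      (∃ i ∈ s, ¬ p ^ m ∣ a i) → ∃ S', S ≤ S' ∧ IsFractionClosedPca Q p κ S' ∧
        ∃ g : σ → T, (∀ i, g i ∈ S') ∧ c = ∑ i ∈ s, g i * a i := by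
    induction m with
    | zero => simp
    | succ m ih =>
      intro a c ha hc hct hm
      by_cases hp : ∃ j ∈ s, ¬ p ∣ a j
      · obtain ⟨j, hjs, hj⟩ := hp
        obtain ⟨S', hSS', hS', hx⟩ := hlift s (Ideal.span {a j}) fun i hi =>
          hj (hS.dvd_of_mem (ha j) (hi (Ideal.mem_span_singleton_self _)))
        have hx' (i : σ) : ∃ x ∈ S', i ∈ s → a j ∣ t i - x := by
          by_cases hi : i ∈ s
          · obtain ⟨x, hx1, hx2⟩ := hx i hi
            exact ⟨x, hx1, fun _ => (dvd_sub_comm).mp (Ideal.mem_span_singleton.mp hx2)⟩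
          · exact ⟨0, S'.zero_mem, fun h => (hi h).elim⟩
        choose x hxS hxd using hx'
        obtain ⟨y, hy⟩ : a j ∣ c - ∑ i ∈ s, x i * a i := by
          rw [hct, ← Finset.sum_sub_distrib]
          refine Finset.dvd_sum fun i hi => ?_
          rw [← sub_mul]
          exact (hxd i hi).mul_right _
        have hyS : y ∈ S' := by
          refine hS'.closed (a j) (hSS' (ha j)) (fun h => hj (h ▸ dvd_zero p)) y ?_
          rw [← hy]
          exact S'.sub_mem (hSS' hc)
            (S'.sum_mem fun i _ => S'.mul_mem (hxS i) (hSS' (ha i)))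
        refine ⟨S', hSS', hS', fun i => x i + if i = j then y else 0, fun i => ?_, ?_⟩
        · refine S'.add_mem (hxS i) ?_
          split_ifs
          exacts [hyS, S'.zero_mem]
        · simp only [add_mul, ite_mul, zero_mul, Finset.sum_add_distrib, Finset.sum_ite_eq', hjs,
            if_true]
          linear_combination hy
      · push Not at hp
        have ha' (i : σ) : ∃ b ∈ S, i ∈ s → a i = p * b := by
          by_cases hi : i ∈ s
          · obtain ⟨b, hb⟩ := hp i hi
            exact ⟨b, hS.closed p hS.p_mem hp0 b (hb ▸ ha i), fun _ => hb⟩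
          · exact ⟨0, S.zero_mem, fun h => (hi h).elim⟩
        choose b hbS hb using ha'
        have hcb : c = p * ∑ i ∈ s, t i * b i := by
          rw [hct, Finset.mul_sum]
          exact Finset.sum_congr rfl fun i hi => by rw [hb i hi]; ring
        obtain ⟨S', hSS', hS', g, hg, hgc⟩ := ih b (∑ i ∈ s, t i * b i) hbS
          (hS.closed p hS.p_mem hp0 _ (hcb ▸ hc)) rfl (by
            obtain ⟨i, hi, hmi⟩ := hm
            refine ⟨i, hi, fun h => hmi ?_⟩
            rw [hb i hi, pow_succ']
            exact mul_dvd_mul_left p h)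
        refine ⟨S', hSS', hS', g, hg, ?_⟩
        rw [hcb, hgc, Finset.mul_sum]
        exact Finset.sum_congr rfl fun i hi => by rw [hb i hi]; ring
  push Not at h0
  obtain ⟨i, hi, hi0⟩ := h0
  obtain ⟨m, hm⟩ := not_forall.mp (mt (hsep (a i)) hi0)
  exact key m a c ha hc hct ⟨i, hi, hm⟩

/-- Every fraction-closed pca subring is contained in one over which all finitely generated ideals
are contracted from `T`. -/
theorem IsFractionClosedPca.exists_forall_sum_eq {T : Type u} [CommRing T] {ι : Type*}
    {Q : ι → Ideal T} {p : T} {κ : Cardinal.{u}} (hκ : ℵ₀ ≤ κ)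
    (hexists : ∀ S, IsFractionClosedPca Q p κ S → ∀ (s : Finset S) (c : S) (t : S → T),
      (c : T) = ∑ i ∈ s, t i * i → ∃ S', S ≤ S' ∧ IsFractionClosedPca Q p κ S' ∧
        ∃ g : S → T, (∀ i, g i ∈ S') ∧ (c : T) = ∑ i ∈ s, g i * i)
    {R : Subring T} (hR : IsFractionClosedPca Q p κ R) :
    ∃ S, R ≤ S ∧ IsFractionClosedPca Q p κ S ∧ ∀ (s : Finset T) (c : T), (∀ x ∈ s, x ∈ S) → c ∈ S →
      c ∈ Ideal.span (s : Set T) → ∃ g : T → T, (∀ x, g x ∈ S) ∧ c = ∑ x ∈ s, g x * x := by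
  classical
  let Solved (s : Finset T) (c : T) (S : Subring T) : Prop :=
    c ∈ Ideal.span (s : Set T) → ∃ g : T → T, (∀ x, g x ∈ S) ∧ c = ∑ x ∈ s, g x * x
  have hmono (s : Finset T) (c : T) : Monotone (Solved s c) := fun S S' hSS' h hc => by
    obtain ⟨g, hg, hgc⟩ := h hc
    exact ⟨g, fun x => hSS' (hg x), hgc⟩
  have hpass (S : Subring T) (hS : IsFractionClosedPca Q p κ S) :
      ∃ S', S ≤ S' ∧ IsFractionClosedPca Q p κ S' ∧
        ∀ (s : Finset T) (c : T), (∀ x ∈ s, x ∈ S) → c ∈ S → Solved s c S' := by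
    have hcard : #(List S × S) ≤ κ := by
      rw [mk_prod, lift_id, lift_id]
      exact mul_le_of_le hκ ((mk_list_le_max _).trans (max_le hκ hS.card_le)) hS.card_le
    obtain ⟨S', h1, h2, h3⟩ := exists_ge_forall_of_forall_exists_ge hκ
      (fun A => isFractionClosedPca_sSup hκ) hcard
      (Solved := fun ω => Solved (ω.1.map Subtype.val).toFinset ω.2)
      (fun ω => hmono _ _) hS (fun ω U hSU hU => by
        by_cases hc : (ω.2 : T) ∈ Ideal.span (((ω.1.map Subtype.val).toFinset : Finset T) : Set T)
        swap
        · exact ⟨U, le_rfl, hU, fun h => (hc h).elim⟩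
        obtain ⟨t, -, ht⟩ := Submodule.mem_span_finset.mp hc
        have hmem (x) (hx : x ∈ (ω.1.map Subtype.val).toFinset) : x ∈ U := by
          simp only [List.mem_toFinset, List.mem_map] at hx
          obtain ⟨y, -, rfl⟩ := hx
          exact hSU y.2
        obtain ⟨U', hUU', hU', g, hg, hgc⟩ := hexists U hU
          ((ω.1.map Subtype.val).toFinset.subtype (· ∈ U)) ⟨ω.2, hSU ω.2.2⟩ (fun x => t x) (by
            rw [Finset.sum_subtype_of_mem (fun x => t x * x) hmem]
            exact ht.symm)
        refine ⟨U', hUU', hU', fun _ => ⟨fun x => if h : x ∈ U then g ⟨x, h⟩ else 0, ?_, ?_⟩⟩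
        · intro x
          dsimp only
          split_ifs
          exacts [hg _, U'.zero_mem]
        · rw [← Finset.sum_subtype_of_mem _ hmem]
          simpa using hgc)
    refine ⟨S', h1, h2, fun s c hs hc => ?_⟩
    convert h3 ⟨s.attach.toList.map fun x : s => ⟨x, hs x x.2⟩, c, hc⟩
    ext x
    simp
  choose! next hle hnext hsolved using hpass
  let F : ℕ → Subring T := fun n => next^[n] R
  have hF (n : ℕ) : F (n + 1) = next (F n) := Function.iterate_succ_apply' _ _ _
  have hgood (n : ℕ) : IsFractionClosedPca Q p κ (F n) := by
    induction n with
    | zero => exact hR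
    | succ n ih => exact hF n ▸ hnext _ ih
  have hFmono : Monotone F := monotone_nat_of_le_succ fun n => hF n ▸ hle _ (hgood n)
  have hdir : DirectedOn (· ≤ ·) (Set.range F) := by
    rintro _ ⟨m, rfl⟩ _ ⟨n, rfl⟩
    exact ⟨_, ⟨max m n, rfl⟩, hFmono (le_max_left _ _), hFmono (le_max_right _ _)⟩
  have hne : (Set.range F).Nonempty := Set.range_nonempty F
  refine ⟨sSup (Set.range F), le_sSup ⟨0, rfl⟩, isFractionClosedPca_sSup hκ hne hdir ?_ ?_, ?_⟩
  · exact (Set.countable_range F).le_aleph0.trans hκ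
  · rintro _ ⟨n, rfl⟩
    exact hgood n
  · intro s c hs hc
    have hmem {x : T} : x ∈ sSup (Set.range F) → ∃ n, x ∈ F n := fun hx => by
      simpa using (Subring.mem_sSup_of_directedOn hne hdir).mp hx
    have hfin (s : Finset T) : (∀ x ∈ s, x ∈ sSup (Set.range F)) → ∃ n, ∀ x ∈ s, x ∈ F n := by
      induction s using Finset.induction_on with
      | empty => simp
      | insert a s _ ih =>
        intro h
        obtain ⟨n, hn⟩ := ih fun x hx => h x (Finset.mem_insert_of_mem hx)
        obtain ⟨m, hm⟩ := hmem (h a (Finset.mem_insert_self _ _))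
        refine ⟨max m n, fun x hx => ?_⟩
        rcases Finset.mem_insert.mp hx with rfl | hx
        · exact hFmono (le_max_left _ _) hm
        · exact hFmono (le_max_right _ _) (hn x hx)
    obtain ⟨n, hn⟩ := hfin (insert c s) fun x hx => by
      rcases Finset.mem_insert.mp hx with rfl | hx
      exacts [hc, hs x hx]
    refine hmono s c (le_sSup ⟨n + 1, hF n⟩) (hsolved _ (hgood n) s c ?_ ?_)
    · exact fun x hx => hn x (Finset.mem_insert_of_mem hx)
    · exact hn c (Finset.mem_insert_self _ _)

end

/-- **Lemma 9.** There is a `p`ca subring `S ⊇ R` with `Γ(S) = Γ(R)` hitting the coset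
`u + J`, with `S ∩ J ⊄ Qᵢ` when `u ∈ J`, and with `IT ∩ S = I` for every finitely
generated ideal `I` of `S`. -/
theorem statement6
    {T : Type u} [CommRing T] [IsLocalRing T] [IsNoetherianRing T]
    [IsAdicComplete (IsLocalRing.maximalIdeal T) T]
    {k : ℕ} (hk : 0 < k) (Q : Fin k → Ideal T)
    (hQprime : ∀ i, (Q i).IsPrime)
    (hQnonmax : ∀ i, Q i ≠ IsLocalRing.maximalIdeal T)
    (hQinc : ∀ i j, Q i ≤ Q j → Q i = Q j)
    (p : T) (hp0 : p ≠ 0) (hpreg : p ∈ nonZeroDivisors T) (hpQ : ∀ i, p ∈ Q i)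
    (hdim : 1 ≤ ringKrullDim T)
    (hAss : ∀ P ∈ associatedPrimes T (T ⧸ Ideal.span {p}), ∀ x ∈ P, ∃ i, x ∈ Q i)
    (R : Subring T) (hR : IsPcaSubring Q p R)
    (hpR : ∀ x ∈ R, x ∈ Ideal.span {p} ↔ ∃ r ∈ R, x = p * r)
    (J : Ideal T) (hJ : ∀ i, ¬ J ≤ Q i) (u : T) :
    ∃ S : Subring T, IsPcaSubring Q p S ∧ R ≤ S ∧ Gamma ↥S = Gamma ↥R ∧
      (∃ s ∈ S, Ideal.Quotient.mk J s = Ideal.Quotient.mk J u) ∧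
      (u ∈ J → ∀ i, ¬ ((J : Set T) ∩ (S : Set T) ⊆ (Q i : Set T))) ∧
      (∀ I : Ideal ↥S, I.FG → (I.map S.subtype).comap S.subtype = I) := by
  have hκ : Cardinal.aleph0 ≤ Gamma R := le_max_right _ _
  obtain ⟨hpR', -, hκT, hRass, hRavoid⟩ := hR
  have hpm : p ∈ IsLocalRing.maximalIdeal T :=
    IsLocalRing.le_maximalIdeal (hQprime ⟨0, hk⟩).ne_top (hpQ ⟨0, hk⟩)
  have hsep (t : T) (ht : ∀ n, p ^ n ∣ t) : t = 0 := by
    rw [← Ideal.mem_bot, ← Ideal.iInf_pow_eq_bot_of_isLocalRing (IsLocalRing.maximalIdeal T)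
      (IsLocalRing.maximalIdeal.isMaximal T).ne_top, Ideal.mem_iInf]
    exact fun n => Ideal.mem_of_dvd _ (ht n) (Ideal.pow_mem_pow hpm n)
  have hdvd (v : T) (hv : ∀ i, v ∉ Q i) (t : T) (ht : p ∣ v * t) : p ∣ t := by
    by_contra hpt
    have hv' : v ∈ ⋃ P ∈ associatedPrimes T (T ⧸ Ideal.span {p}), (P : Set T) := by
      rw [biUnion_associatedPrimes_eq_zero_divisors]
      refine ⟨Ideal.Quotient.mk _ t, ?_, ?_⟩
      · rwa [ne_eq, Ideal.Quotient.eq_zero_iff_mem, Ideal.mem_span_singleton]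
      · rw [← Ideal.mem_span_singleton, ← Ideal.Quotient.eq_zero_iff_mem, map_mul] at ht
        rwa [Algebra.smul_def]
    simp only [Set.mem_iUnion] at hv'
    obtain ⟨P, hP, hvP⟩ := hv'
    obtain ⟨i, hi⟩ := hAss P hP v hvP
    exact hv i hi
  have hbase : IsFractionClosedPca Q p (Gamma R) (fractionClosure R) := by
    refine isFractionClosedPca_fractionClosure hκ hpR' (le_max_left _ _) ?_ ?_
    · intro x hx hx0
      by_contra hreg
      have hx' : x ∈ ⋃ P ∈ associatedPrimes T T, (P : Set T) := by
        rw [biUnion_associatedPrimes_eq_compl_nonZeroDivisors]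
        exact hreg
      simp only [Set.mem_iUnion] at hx'
      obtain ⟨P, hP, hxP⟩ := hx'
      exact hx0 (hRass P hP x hx hxP)
    · intro i q hq r hr hqr h0
      by_contra hpq
      exact h0 (hRavoid i _ ⟨q, hq, mt Ideal.mem_span_singleton.mp hpq, r, hr, rfl⟩ hqr)
  have hext (S : Subring T) (hS : IsFractionClosedPca Q p (Gamma R) S) (J : Ideal T)
      (hJ : ∀ i, ¬ J ≤ Q i) (u : T) : ∃ S', S ≤ S' ∧ IsFractionClosedPca Q p (Gamma R) S' ∧
        ∃ x ∈ S', x - u ∈ J ∧ ∀ i, x ∉ Q i := by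
    obtain ⟨x, hxJ, hx⟩ :=
      exists_sub_mem_forall_coeff_mem hQprime hQnonmax hκ hκT hS.card_le hJ u
    refine ⟨fractionClosure (Polynomial.eval₂RingHom S.subtype x).range,
      fun r hr => le_fractionClosure _ ⟨Polynomial.C ⟨r, hr⟩, by simp⟩,
      hS.adjoin hκ hpreg hsep hdvd hx, x, le_fractionClosure _ ⟨Polynomial.X, by simp⟩, hxJ,
      fun i hi => (hQprime i).ne_top ((Ideal.eq_top_iff_one _).mpr ?_)⟩
    simpa using hx i Polynomial.X (by simpa using hi) 1
  obtain ⟨S₀, hRS₀, hS₀, x, hxS₀, hxJ, hxQ⟩ := hext _ hbase J hJ u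
  obtain ⟨S, hS₀S, hS, hsolve⟩ := IsFractionClosedPca.exists_forall_sum_eq hκ
    (fun S hS s c t h => hS.exists_sum_eq hp0 hsep
      (fun S hS J hJ u => by
        obtain ⟨S', h1, h2, x, hx, hxJ, -⟩ := hext S hS J hJ u
        exact ⟨S', h1, h2, x, hx, hxJ⟩)
      s Subtype.val Subtype.prop c c.2 t h) hS₀
  have hRS : R ≤ S := (le_fractionClosure R).trans (hRS₀.trans hS₀S)
  have hΓ : Gamma S = Gamma R := le_antisymm (max_le hS.card_le hκ)
    (max_le_max_right _ (Cardinal.mk_le_mk_of_subset hRS))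
  refine ⟨S, ⟨hS.p_mem, fun y hy => ?_, hΓ ▸ hκT, fun P hP y hyS hyP => ?_, ?_⟩, hRS, hΓ,
    ⟨x, hS₀S hxS₀, Ideal.Quotient.eq.mpr hxJ⟩, fun hu i h => ?_, fun I hI => ?_⟩
  · obtain ⟨z, hz⟩ := (IsLocalRing.notMem_maximalIdeal.mp hy).exists_right_inv
    have hy0 : (y : T) ≠ 0 := left_ne_zero_of_mul_eq_one hz
    exact IsUnit.of_mul_eq_one ⟨z, hS.closed y y.2 hy0 z (hz ▸ S.one_mem)⟩ (Subtype.ext hz)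
  · by_contra hy0
    have h : y ∈ ⋃ P ∈ associatedPrimes T T, (P : Set T) := Set.mem_biUnion hP hyP
    rw [biUnion_associatedPrimes_eq_compl_nonZeroDivisors] at h
    exact h (hS.regular y hyS hy0)
  · rintro i _ ⟨q, hq, hqp, r, hr, rfl⟩ hqr
    by_contra h0
    exact hqp (Ideal.mem_span_singleton.mpr (hS.avoid i q hq r hr hqr h0))
  · refine hxQ i (h ⟨?_, hS₀S hxS₀⟩)
    simpa using J.add_mem hxJ hu
  · classical
    refine le_antisymm (fun c hc => ?_) Ideal.le_comap_map
    obtain ⟨s, rfl⟩ := hI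
    rw [Ideal.mem_comap, Ideal.map_span, ← Finset.coe_image] at hc
    have hmem : ∀ x ∈ s.image S.subtype, x ∈ S := by simp +contextual
    obtain ⟨g, hg, hgc⟩ := hsolve (s.image S.subtype) c hmem c.2 hc
    have hc' : c = ∑ x ∈ s, ⟨g x, hg x⟩ * x := Subtype.ext <| by
      rw [hgc, Finset.sum_image S.subtype_injective.injOn]
      simp
    rw [hc']
    exact Ideal.sum_mem _ fun x hx => Ideal.mul_mem_left _ _ (Ideal.subset_span hx)
end

section
/- Let Π denote the prime subring of T. Suppose that: (a) P ∩ Π[p] = (0) for all associated primes P of T; (b) every associated prime P' of the T-module T/pT satisfies P' ⊆ Qᵢ for some i ∈ {1, …, k}; and (c) ((Qᵢ \ pT)Π[p]) ∩ Π[p] = {0} for all i ∈ {1, …, k}. Then there exists a local (Noetherian quasilocal) domain A ⊆ T with p ∈ A such that the inclusion A ⊆ T induces an isomorphism of the (A ∩ 𝔪)-adic completion of A with T, pA is a prime ideal of A, Qᵢ ∩ A = pA for every i, and every prime ideal Q of T with Q ∩ A = pA satisfies Q ⊆ Qᵢ for some i ∈ {1, …, k}. -/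
universe u

open Polynomial Cardinal

/-- Every nonzero element of `R` is a power of `p` times an element of `R` outside all `Q i`. -/
def IsAdequate {T : Type u} [CommRing T] {k : ℕ} (Q : Fin k → Ideal T) (p : T)
    (R : Subring T) : Prop :=
  p ∈ R ∧ ∀ r ∈ R, r ≠ 0 → ∃ n : ℕ, ∃ s ∈ R, (∀ i, s ∉ Q i) ∧ r = p ^ n * s

/-- The intersection of `T` with the ring of fractions of `R` inside the total ring of fractions
of `T`. -/
def divClosure {T : Type u} [CommRing T] (R : Subring T) : Subring T where
  carrier := {t | ∃ r ∈ R, r ∈ nonZeroDivisors T ∧ r * t ∈ R}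
  mul_mem' := by
    rintro a b ⟨r, hr, hr', ha⟩ ⟨s, hs, hs', hb⟩
    refine ⟨r * s, mul_mem hr hs, mul_mem hr' hs', ?_⟩
    rw [mul_mul_mul_comm]
    exact mul_mem ha hb
  one_mem' := ⟨1, one_mem _, one_mem _, by simp [one_mem]⟩
  add_mem' := by
    rintro a b ⟨r, hr, hr', ha⟩ ⟨s, hs, hs', hb⟩
    refine ⟨r * s, mul_mem hr hs, mul_mem hr' hs', ?_⟩
    rw [show r * s * (a + b) = s * (r * a) + r * (s * b) by ring]
    exact add_mem (mul_mem hs ha) (mul_mem hr hb)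
  zero_mem' := ⟨1, one_mem _, one_mem _, by simp [zero_mem]⟩
  neg_mem' := by
    rintro a ⟨r, hr, hr', ha⟩
    exact ⟨r, hr, hr', by simpa using neg_mem ha⟩

lemma mem_divClosure {T : Type u} [CommRing T] {R : Subring T} {t : T} :
    t ∈ divClosure R ↔ ∃ r ∈ R, r ∈ nonZeroDivisors T ∧ r * t ∈ R := Iff.rfl

lemma le_divClosure {T : Type u} [CommRing T] (R : Subring T) : R ≤ divClosure R :=
  fun t ht => ⟨1, one_mem _, one_mem _, by simpa using ht⟩

lemma mem_divClosure_of_mul_mem {T : Type u} [CommRing T] {R : Subring T} {s t : T}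
    (hs : s ∈ divClosure R) (hs' : s ∈ nonZeroDivisors T) (hst : s * t ∈ divClosure R) :
    t ∈ divClosure R := by
  obtain ⟨a, ha, ha', has⟩ := hs
  obtain ⟨b, hb, hb', hbst⟩ := hst
  refine ⟨b * (a * s), mul_mem hb has, mul_mem hb' (mul_mem ha' hs'), ?_⟩
  rw [show b * (a * s) * t = a * (b * (s * t)) by ring]
  exact mul_mem ha hbst

lemma mk_divClosure_le {T : Type u} [CommRing T] (R : Subring T) :
    #(divClosure R) ≤ #R * #R := by
  choose r hr hr' hrt using fun t : divClosure R => t.2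
  rw [Cardinal.mul_def]
  refine Cardinal.mk_le_of_injective
    (f := fun t => ((⟨r t, hr t⟩ : R), (⟨r t * t, hrt t⟩ : R))) fun a b hab => ?_
  simp only [Prod.mk.injEq, Subtype.mk.injEq] at hab
  obtain ⟨h1, h2⟩ := hab
  rw [← h1] at h2
  exact Subtype.ext ((mul_cancel_left_mem_nonZeroDivisors (hr' a)).1 h2)

lemma mem_nonZeroDivisors_of_notMem {T : Type u} [CommRing T] {k : ℕ} {Q : Fin k → Ideal T}
    {p : T} (hp : p ∈ nonZeroDivisors T)
    (hreg : ∀ x t, (∀ i, x ∉ Q i) → x * t ∈ Ideal.span {p} → t ∈ Ideal.span {p})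
    (hpow : ∀ t : T, t ≠ 0 → ∃ n : ℕ, ∃ s, t = p ^ n * s ∧ s ∉ Ideal.span {p})
    {x : T} (hx : ∀ i, x ∉ Q i) : x ∈ nonZeroDivisors T := by
  rw [mem_nonZeroDivisors_iff_left]
  intro t ht
  by_contra h
  obtain ⟨n, s, rfl, hs⟩ := hpow t h
  have : p ^ n * (x * s) = p ^ n * 0 := by rw [mul_zero, ← ht]; ring
  rw [mul_cancel_left_mem_nonZeroDivisors (pow_mem hp n)] at this
  exact hs (hreg x s hx (by rw [this]; exact zero_mem _))

section Adequate

variable {T : Type u} [CommRing T] {k : ℕ} {Q : Fin k → Ideal T} {p : T} {R : Subring T}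

lemma IsAdequate.exists_eq_mul (hR : IsAdequate Q p R) {c : T} (hc : c ∈ R) {i : Fin k}
    (hci : c ∈ Q i) : ∃ d ∈ R, c = p * d := by
  by_cases h0 : c = 0
  · exact ⟨0, zero_mem _, by simp [h0]⟩
  obtain ⟨n, s, hs, hsQ, rfl⟩ := hR.2 c hc h0
  cases n with
  | zero => exact absurd (by simpa using hci) (hsQ i)
  | succ n => exact ⟨p ^ n * s, mul_mem (pow_mem hR.1 n) hs, by ring⟩

lemma IsAdequate.mem_nonZeroDivisors (hR : IsAdequate Q p R) (hp : p ∈ nonZeroDivisors T)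
    (hQ : ∀ x : T, (∀ i, x ∉ Q i) → x ∈ nonZeroDivisors T)
    {r : T} (hr : r ∈ R) (h0 : r ≠ 0) : r ∈ nonZeroDivisors T := by
  obtain ⟨n, s, hs, hsQ, rfl⟩ := hR.2 r hr h0
  exact mul_mem (pow_mem hp n) (hQ s hsQ)

lemma IsAdequate.exists_polynomial_eq (hR : IsAdequate Q p R) (hp : p ∈ nonZeroDivisors T)
    {x : T} (hx : ∀ i, ∀ f : R[X], aeval x f ∈ Q i → ∀ n, (f.coeff n : T) ∈ Q i) (N : ℕ) :
    ∀ f : R[X], ∀ m : ℕ, ∀ s : T, (∀ i, s ∉ Q i) → (f.coeff m : T) = p ^ N * s →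
      ∃ n : ℕ, ∃ g : R[X], (∀ i, aeval x g ∉ Q i) ∧ aeval x f = p ^ n * aeval x g := by
  induction N with
  | zero =>
    intro f m s hs hf
    refine ⟨0, f, fun i hi => hs i ?_, by simp⟩
    have := hx i f hi m
    rwa [hf, pow_zero, one_mul] at this
  | succ N ih =>
    intro f m s hs hf
    by_cases h : ∀ i, aeval x f ∉ Q i
    · exact ⟨0, f, h, by simp⟩
    push Not at h
    obtain ⟨i, hi⟩ := h
    have hdvd : C (⟨p, hR.1⟩ : R) ∣ f := by
      rw [C_dvd_iff_dvd_coeff]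
      intro n
      obtain ⟨d, hd, hcd⟩ := hR.exists_eq_mul (f.coeff n).2 (hx i f hi n)
      exact ⟨⟨d, hd⟩, Subtype.ext hcd⟩
    obtain ⟨g, rfl⟩ := hdvd
    have hg : (g.coeff m : T) = p ^ N * s := by
      rw [coeff_C_mul] at hf
      have : p * (g.coeff m : T) = p * (p ^ N * s) := by
        rw [← mul_assoc, ← pow_succ', ← hf]; rfl
      exact (mul_cancel_left_mem_nonZeroDivisors hp).1 this
    obtain ⟨n, g', hg', hgg'⟩ := ih g m s hs hg
    refine ⟨n + 1, g', hg', ?_⟩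
    rw [map_mul, aeval_C, hgg', pow_succ', mul_assoc]
    rfl

lemma exists_aeval_of_mem_closure_insert {T : Type u} [CommRing T] (R : Subring T) (x : T) {r : T}
    (hr : r ∈ Subring.closure (insert x (R : Set T))) : ∃ f : R[X], aeval x f = r := by
  have : Subring.closure (insert x (R : Set T)) ≤ (aeval (R := R) x).toRingHom.range := by
    rw [Subring.closure_le]
    rintro y (rfl | hy)
    · exact ⟨X, by simp⟩
    · exact ⟨C ⟨y, hy⟩, by simp [Algebra.algebraMap_eq_smul_one, Subring.smul_def]⟩
  exact this hr

lemma aeval_mem_closure_insert {T : Type u} [CommRing T] (R : Subring T) (x : T) (f : R[X]) :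
    aeval x f ∈ Subring.closure (insert x (R : Set T)) := by
  rw [aeval_eq_sum_range]
  refine sum_mem fun i _ => ?_
  rw [Subring.smul_def, smul_eq_mul]
  exact mul_mem (Subring.subset_closure (Set.mem_insert_of_mem _ (f.coeff i).2))
    (pow_mem (Subring.subset_closure (Set.mem_insert _ _)) i)

/-- Adjoining an element which is transcendental modulo every `Q i` preserves adequacy. -/
lemma IsAdequate.closure_insert (hR : IsAdequate Q p R) (hp : p ∈ nonZeroDivisors T)
    {x : T} (hx : ∀ i, ∀ f : R[X], aeval x f ∈ Q i → ∀ n, (f.coeff n : T) ∈ Q i) :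
    IsAdequate Q p (Subring.closure (insert x (R : Set T))) := by
  refine ⟨Subring.subset_closure (Set.mem_insert_of_mem _ hR.1), fun r hr h0 => ?_⟩
  obtain ⟨f, rfl⟩ := exists_aeval_of_mem_closure_insert R x hr
  have hf : f ≠ 0 := by rintro rfl; simp at h0
  obtain ⟨m, hm⟩ : ∃ m, f.coeff m ≠ 0 := by
    by_contra! h
    exact hf (Polynomial.ext h)
  obtain ⟨N, s, -, hsQ, hs⟩ := hR.2 _ (f.coeff m).2 (by simpa using hm)
  obtain ⟨n, g, hg, hfg⟩ := hR.exists_polynomial_eq hp hx N f m s hsQ hs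
  exact ⟨n, _, aeval_mem_closure_insert R x g, hg, hfg⟩

lemma isAdequate_divClosure_of_compAvoid (hp : p ∈ nonZeroDivisors T) (hpR : p ∈ R)
    (hpow : ∀ t : T, t ≠ 0 → ∃ n : ℕ, ∃ s, t = p ^ n * s ∧ s ∉ Ideal.span {p})
    (hR : ∀ i, ∀ t ∈ CompAvoid (Q i) p (R : Set T), t ∈ R → t = 0) :
    IsAdequate Q p (divClosure R) := by
  refine ⟨le_divClosure R hpR, fun t ht h0 => ?_⟩
  obtain ⟨n, s, rfl, hs⟩ := hpow t h0
  have hs' : s ∈ divClosure R :=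
    mem_divClosure_of_mul_mem (pow_mem (le_divClosure R hpR) n) (pow_mem hp n) ht
  refine ⟨n, s, hs', fun i hi => ?_, rfl⟩
  obtain ⟨r, hr, hr', hrs⟩ := hs'
  have h1 : r * s = 0 := hR i _ ⟨s, hi, hs, r, hr, mul_comm _ _⟩ hrs
  have h2 : s = 0 := (mem_nonZeroDivisors_iff_left.1 hr') s h1
  exact hs (by rw [h2]; exact zero_mem _)

/-- The division closure of an adequate ring is adequate. -/
lemma IsAdequate.divClosure (hR : IsAdequate Q p R) (hp : p ∈ nonZeroDivisors T)
    (hreg : ∀ x t, (∀ i, x ∉ Q i) → x * t ∈ Ideal.span {p} → t ∈ Ideal.span {p})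
    (hpow : ∀ t : T, t ≠ 0 → ∃ n : ℕ, ∃ s, t = p ^ n * s ∧ s ∉ Ideal.span {p}) :
    IsAdequate Q p (divClosure R) := by
  refine isAdequate_divClosure_of_compAvoid hp hR.1 hpow ?_
  rintro i _ ⟨q, hq, hqp, r, hr, rfl⟩ hqr
  by_contra h0
  obtain ⟨n, s, hs, hsQ, rfl⟩ := hR.2 r hr (right_ne_zero_of_mul h0)
  obtain ⟨m, w, hw, hwQ, hqw⟩ := hR.2 _ hqr h0
  rcases le_or_gt m n with hmn | hmn
  · obtain ⟨d, rfl⟩ := Nat.exists_eq_add_of_le hmn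
    have : p ^ m * (q * (p ^ d * s)) = p ^ m * w := by rw [← hqw]; ring
    rw [mul_cancel_left_mem_nonZeroDivisors (pow_mem hp m)] at this
    exact hwQ i (this ▸ Ideal.mul_mem_right _ _ hq)
  · obtain ⟨d, rfl⟩ := Nat.exists_eq_add_of_lt hmn
    have : p ^ n * (s * q) = p ^ n * (p * (p ^ d * w)) := by
      rw [show p ^ n * (s * q) = q * (p ^ n * s) by ring, hqw]; ring
    rw [mul_cancel_left_mem_nonZeroDivisors (pow_mem hp n)] at this
    exact hqp (hreg s q hsQ (this ▸ Ideal.mul_mem_right _ _ (Ideal.mem_span_singleton_self p)))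

end Adequate

lemma exists_adic_limit {T : Type u} [CommRing T] (I : Ideal T) [IsPrecomplete I T] (f : ℕ → T)
    (hf : ∀ n, f (n + 1) - f n ∈ I ^ n) : ∃ L, ∀ n, L - f n ∈ I ^ n := by
  have key : ∀ m d, f (m + d) - f m ∈ I ^ m := by
    intro m d
    induction d with
    | zero => simp
    | succ d ih =>
      have := add_mem (Ideal.pow_le_pow_right (Nat.le_add_right m d) (hf (m + d))) ih
      simpa [add_assoc] using this
  obtain ⟨L, hL⟩ := IsPrecomplete.prec (I := I) (M := T) inferInstance (f := f) (by
    intro m n hmn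
    obtain ⟨d, rfl⟩ := Nat.exists_eq_add_of_le hmn
    refine (SModEq.sub_mem.2 ?_).symm
    simpa using key m d)
  exact ⟨L, fun n => by simpa using SModEq.sub_mem.1 (hL n).symm⟩

lemma eq_zero_of_forall_mem_pow {T : Type u} [CommRing T] (I : Ideal T) [IsHausdorff I T] {x : T}
    (hx : ∀ n, x ∈ I ^ n) : x = 0 :=
  IsHausdorff.haus (I := I) inferInstance x fun n => SModEq.sub_mem.2 (by simpa using hx n)

lemma aleph0_lt_mk_nat_arrow (K : Type u) [Nontrivial K] : ℵ₀ < #(ℕ → K) := by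
  have h : (2 : Cardinal.{u}) ≤ #K := Cardinal.two_le_iff.2 (exists_pair_ne K)
  calc ℵ₀ < 2 ^ ℵ₀ := Cardinal.cantor _
    _ ≤ #K ^ ℵ₀ := Cardinal.power_le_power_right h
    _ = #(ℕ → K) := by simp

lemma exists_mem_forall_notMem {T : Type u} [CommRing T] {k : ℕ} {Q : Fin k → Ideal T}
    (hQ : ∀ i, (Q i).IsPrime) {I : Ideal T} (hI : ∀ i, ¬ I ≤ Q i) : ∃ x ∈ I, ∀ i, x ∉ Q i := by
  rcases isEmpty_or_nonempty (Fin k) with _ | ⟨⟨a⟩⟩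
  · exact ⟨0, zero_mem _, isEmptyElim⟩
  by_contra! h
  have hsub : (I : Set T) ⊆ ⋃ i ∈ ((Finset.univ : Finset (Fin k)) : Set (Fin k)), Q i := by
    intro x hx
    simpa using h x hx
  obtain ⟨i, -, hi⟩ := (Ideal.subset_union_prime a a (fun i _ _ _ => hQ i)).1 hsub
  exact hI i hi

section Local

variable {T : Type u} [CommRing T] [IsLocalRing T]

open IsLocalRing

lemma mk_quotient_pow_le [IsNoetherianRing T] (n : ℕ) :
    #(T ⧸ maximalIdeal T ^ n) ≤ #(ℕ → ResidueField T) := by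
  have hinf := (aleph0_lt_mk_nat_arrow (ResidueField T)).le
  induction n with
  | zero =>
    have : Subsingleton (T ⧸ maximalIdeal T ^ 0) :=
      Ideal.Quotient.subsingleton_iff.2 (by simp)
    exact (Cardinal.le_one_iff_subsingleton.2 this).trans (Cardinal.one_le_aleph0.trans hinf)
  | succ n ih =>
    obtain ⟨m, g, hg⟩ := Submodule.fg_iff_exists_fin_generating_family.1
      (IsNoetherian.noetherian (maximalIdeal T ^ n))
    choose a ha using Ideal.Quotient.mk_surjective (I := maximalIdeal T ^ n)
    choose r hr using residue_surjective (R := T)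
    let F : (T ⧸ maximalIdeal T ^ n) × (Fin m → ResidueField T) → T ⧸ maximalIdeal T ^ (n + 1) :=
      fun x => Ideal.Quotient.mk _ (a x.1 + ∑ i, r (x.2 i) * g i)
    have hF : Function.Surjective F := by
      intro t
      obtain ⟨t, rfl⟩ := Ideal.Quotient.mk_surjective t
      have h1 : t - a (Ideal.Quotient.mk _ t) ∈ Submodule.span T (Set.range g) := by
        rw [hg, ← Ideal.Quotient.eq, ha]
      obtain ⟨c, hc⟩ := (Submodule.mem_span_range_iff_exists_fun T).1 h1
      refine ⟨(Ideal.Quotient.mk _ t, fun i => residue T (c i)), ?_⟩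
      simp only [F]
      rw [Ideal.Quotient.eq]
      have h2 : ∀ i, g i ∈ maximalIdeal T ^ n := fun i => by
        rw [← hg]; exact Submodule.subset_span (Set.mem_range_self i)
      have h3 : a (Ideal.Quotient.mk _ t) + ∑ i, r (residue T (c i)) * g i - t
          = ∑ i, (r (residue T (c i)) - c i) * g i := by
        have : t = a (Ideal.Quotient.mk _ t) + ∑ i, c i * g i := by
          simp only [smul_eq_mul] at hc
          rw [hc]; ring
        simp only [sub_mul, Finset.sum_sub_distrib]
        linear_combination -this
      rw [h3, pow_succ']
      refine sum_mem fun i _ => Ideal.mul_mem_mul ?_ (h2 i)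
      rw [← residue_eq_zero_iff, map_sub, hr, sub_self]
    have hfin : #(Fin m → ResidueField T) ≤ #(ℕ → ResidueField T) := by
      refine Cardinal.mk_le_of_surjective (f := fun s (i : Fin m) => s i) fun s => ?_
      exact ⟨fun i => if h : i < m then s ⟨i, h⟩ else 0, by ext i; simp⟩
    calc _ ≤ _ := Cardinal.mk_le_of_surjective hF
      _ = #(T ⧸ maximalIdeal T ^ n) * #(Fin m → ResidueField T) := by simp
      _ ≤ #(ℕ → ResidueField T) * #(ℕ → ResidueField T) := mul_le_mul' ih hfin
      _ = _ := Cardinal.mul_eq_self hinf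

lemma mk_le_mk_nat_arrow_residueField_s8 [IsNoetherianRing T] [IsHausdorff (maximalIdeal T) T] :
    #T ≤ #(ℕ → ResidueField T) := by
  have h (n : ℕ) : Nonempty ((T ⧸ maximalIdeal T ^ n) ↪ (ℕ → ResidueField T)) :=
    mk_quotient_pow_le n
  refine Cardinal.mk_le_of_injective
    (f := fun t j => (h j.unpair.1).some (Ideal.Quotient.mk _ t) j.unpair.2) fun s t hst => ?_
  rw [← sub_eq_zero]
  refine eq_zero_of_forall_mem_pow (maximalIdeal T) fun n => ?_
  rw [← Ideal.Quotient.eq]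
  apply (h n).some.injective
  ext m
  obtain ⟨j, hj⟩ := Nat.surjective_unpair (n, m)
  obtain rfl : j.unpair.1 = n := by rw [hj]
  obtain rfl : j.unpair.2 = m := by rw [hj]
  exact congrFun hst j

/-- Power series in `y` with representatives of residue classes as coefficients give a family of
elements which stay pairwise distinct modulo every prime not containing `y`. -/
lemma exists_family_sub_notMem [IsAdicComplete (maximalIdeal T) T] {y : T}
    (hy : y ∈ maximalIdeal T) :
    ∃ σ : (ℕ → ResidueField T) → T, ∀ P : Ideal T, P.IsPrime → y ∉ P →
      ∀ a b, σ a - σ b ∈ P → a = b := by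
  choose r hr using residue_surjective (R := T)
  have hlim (e : ℕ → ResidueField T) := exists_adic_limit (maximalIdeal T)
    (fun n => ∑ i ∈ Finset.range n, r (e i) * y ^ i) (fun n => by
      rw [Finset.sum_range_succ, add_sub_cancel_left]
      exact Ideal.mul_mem_left _ _ (Ideal.pow_mem_pow hy n))
  choose σ hσ using hlim
  have hshift (e : ℕ → ResidueField T) : σ e = r (e 0) + y * σ (fun i => e (i + 1)) := by
    rw [← sub_eq_zero]
    refine eq_zero_of_forall_mem_pow (maximalIdeal T) fun n => ?_
    have h1 := Ideal.pow_le_pow_right (Nat.le_succ n) (hσ e (n + 1))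
    have h2 := Ideal.mul_mem_left _ y (hσ (fun i => e (i + 1)) n)
    simp only [Finset.sum_range_succ', Finset.mul_sum, mul_sub] at h1 h2
    convert sub_mem h1 h2 using 1
    have : ∀ i, y * (r (e (i + 1)) * y ^ i) = r (e (i + 1)) * y ^ (i + 1) := fun i => by ring
    simp only [this]
    ring
  refine ⟨σ, fun P hP hyP a b hab => ?_⟩
  have hzero : ∀ a b, σ a - σ b ∈ P → a 0 = b 0 := by
    intro a b hab
    have h1 := IsLocalRing.le_maximalIdeal hP.ne_top hab
    rw [hshift a, hshift b] at h1
    have h2 : r (a 0) - r (b 0) ∈ maximalIdeal T := by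
      have h3 := Ideal.mul_mem_right (σ (fun i => a (i + 1)) - σ (fun i => b (i + 1))) _ hy
      convert sub_mem h1 h3 using 1
      ring
    rwa [← residue_eq_zero_iff, map_sub, hr, hr, sub_eq_zero] at h2
  have hall : ∀ n, ∀ a b, σ a - σ b ∈ P → a n = b n := by
    intro n
    induction n with
    | zero => exact hzero
    | succ n ih =>
      intro a b hab
      have h0 := hzero a b hab
      rw [hshift a, hshift b, h0, add_sub_add_left_eq_sub, ← mul_sub] at hab
      exact ih _ _ ((hP.mem_or_mem hab).resolve_left hyP)
  exact funext fun n => hall n a b hab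

lemma not_pow_maximalIdeal_le {P : Ideal T} (hP : P.IsPrime) (hPm : P ≠ maximalIdeal T) (n : ℕ) :
    ¬ maximalIdeal T ^ n ≤ P := fun h =>
  hPm ((IsLocalRing.le_maximalIdeal hP.ne_top).antisymm (hP.le_of_pow_le h))

/-- Over a subring smaller than `T`, each coset of `jT` with `j` outside all `Q i` contains an
element which is transcendental modulo every `Q i`. -/
lemma exists_transcendental_mem_coset [IsNoetherianRing T] [IsAdicComplete (maximalIdeal T) T]
    {k : ℕ} (hk : 0 < k) {Q : Fin k → Ideal T} (hQ : ∀ i, (Q i).IsPrime)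
    (hQm : ∀ i, Q i ≠ maximalIdeal T) (R : Subring T) (hR : #R < #T) (u j : T)
    (hj : ∀ i, j ∉ Q i) :
    ∃ x, x - u ∈ Ideal.span {j} ∧
      ∀ i, ∀ f : R[X], aeval x f ∈ Q i → ∀ n, (f.coeff n : T) ∈ Q i := by
  obtain ⟨y, hy, hyQ⟩ := exists_mem_forall_notMem hQ
    (fun i => by simpa using not_pow_maximalIdeal_le (hQ i) (hQm i) 1)
  obtain ⟨σ, hσ⟩ := exists_family_sub_notMem hy
  by_contra! h
  choose i f hf n hn using fun e => h (u + j * σ e) (by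
    rw [add_sub_cancel_left]
    exact Ideal.mul_mem_right _ _ (Ideal.mem_span_singleton_self j))
  have : Nonempty (Fin k) := ⟨⟨0, hk⟩⟩
  have hT : ℵ₀ < #T := (aleph0_lt_mk_nat_arrow (ResidueField T)).trans_le
    (Cardinal.mk_le_of_injective (f := σ) fun a b hab => hσ (Q ⟨0, hk⟩) (hQ _) (hyQ _) a b
      (by rw [hab, sub_self]; exact zero_mem _))
  have hcard : #(Fin k × R[X]) < #(ℕ → ResidueField T) := by
    refine lt_of_lt_of_le ?_ (mk_le_mk_nat_arrow_residueField_s8 (T := T))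
    simp only [Cardinal.mk_prod, Cardinal.mk_fin, Cardinal.lift_natCast, Cardinal.lift_uzero]
    exact Cardinal.mul_lt_of_lt hT.le (Cardinal.natCast_lt_aleph0.trans hT)
      (Polynomial.cardinalMk_le_max.trans_lt (max_lt hR hT))
  obtain ⟨⟨i₀, f₀⟩, hinf⟩ := Cardinal.exists_infinite_fiber (fun e => (i e, f e)) hcard
  rw [Set.infinite_coe_iff] at hinf
  have := hQ i₀
  let φ : R →+* T ⧸ Q i₀ := (Ideal.Quotient.mk (Q i₀)).comp R.subtype
  have hmem : ∀ e ∈ (fun e => (i e, f e)) ⁻¹' {(i₀, f₀)}, i e = i₀ ∧ f e = f₀ := by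
    intro e he
    simpa using he
  have hne : f₀.map φ ≠ 0 := by
    obtain ⟨e, he⟩ := hinf.nonempty
    obtain ⟨rfl, rfl⟩ := hmem e he
    intro h0
    apply hn e
    rw [← Ideal.Quotient.eq_zero_iff_mem]
    have := congrArg (fun q => q.coeff (n e)) h0
    simpa [φ, coeff_map] using this
  have hroot : ∀ e ∈ (fun e => (i e, f e)) ⁻¹' {(i₀, f₀)},
      Ideal.Quotient.mk (Q i₀) (u + j * σ e) ∈ (f₀.map φ).rootSet (T ⧸ Q i₀) := by
    intro e he
    obtain ⟨h1, h2⟩ := hmem e he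
    rw [mem_rootSet]
    refine ⟨hne, ?_⟩
    have := hf e
    rw [h1, h2, ← Ideal.Quotient.eq_zero_iff_mem, aeval_def, hom_eval₂] at this
    rw [coe_aeval_eq_eval, eval_map]
    exact this
  refine hinf (Set.Finite.of_injOn hroot ?_ (rootSet_finite _ _))
  intro a ha b hb hab
  rw [Ideal.Quotient.eq, add_sub_add_left_eq_sub, ← mul_sub] at hab
  exact hσ _ (hQ i₀) (hyQ i₀) a b (((hQ i₀).mem_or_mem hab).resolve_left (hj i₀))

end Local

lemma mk_closure_le {T : Type u} [CommRing T] (s : Set T) :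
    #(Subring.closure s) ≤ max #s ℵ₀ := by
  have h : (Subring.closure s : Set T) ⊆ Algebra.adjoin ℤ s := by
    have : Subring.closure s ≤ (Algebra.adjoin ℤ s).toSubring :=
      Subring.closure_le.2 Algebra.subset_adjoin
    exact this
  refine (Cardinal.mk_le_mk_of_subset h).trans ((Cardinal.lift_le.{0}).1 ?_)
  refine (Algebra.lift_cardinalMk_adjoin_le ℤ s).trans ?_
  simp only [Cardinal.lift_uzero, Cardinal.mk_int, Cardinal.lift_aleph0]
  exact sup_le (sup_le le_sup_right le_sup_left) le_sup_right

/-- A countable adequate subring is contained in an adequate subring which meets every coset of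
`jT` for every `j` outside all `Q i`. -/
lemma IsAdequate.exists_dense {T : Type u} [CommRing T] [IsLocalRing T] [IsNoetherianRing T]
    [IsAdicComplete (IsLocalRing.maximalIdeal T) T] {k : ℕ} (hk : 0 < k) {Q : Fin k → Ideal T}
    (hQ : ∀ i, (Q i).IsPrime) (hQm : ∀ i, Q i ≠ IsLocalRing.maximalIdeal T) {p : T}
    (hp : p ∈ nonZeroDivisors T) {R₀ : Subring T} (hR₀ : IsAdequate Q p R₀) (hc : #R₀ ≤ ℵ₀)
    (hT : ℵ₀ < #T) :
    ∃ R : Subring T, IsAdequate Q p R ∧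
      ∀ u j : T, (∀ i, j ∉ Q i) → ∃ x ∈ R, x - u ∈ Ideal.span {j} := by
  have hstep : ∀ (B : Set T) (q : T × T), ∃ x : T, #B < #T →
      ((∀ i, q.2 ∉ Q i) → x - q.1 ∈ Ideal.span {q.2}) ∧
      ∀ i, ∀ f : (Subring.closure (R₀ ∪ B : Set T))[X], aeval x f ∈ Q i →
        ∀ n, (f.coeff n : T) ∈ Q i := by
    intro B q
    by_cases hB : #B < #T
    swap
    · exact ⟨0, fun h => absurd h hB⟩
    have hcl : #(Subring.closure (R₀ ∪ B : Set T)) < #T := by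
      refine (mk_closure_le _).trans_lt (max_lt ((Cardinal.mk_union_le _ _).trans_lt ?_) hT)
      exact Cardinal.add_lt_of_lt hT.le (hc.trans_lt hT) hB
    by_cases hq : ∀ i, q.2 ∉ Q i
    · obtain ⟨x, hx, hx'⟩ := exists_transcendental_mem_coset hk hQ hQm _ hcl q.1 q.2 hq
      exact ⟨x, fun _ => ⟨fun _ => hx, hx'⟩⟩
    · obtain ⟨x, -, hx'⟩ := exists_transcendental_mem_coset hk hQ hQm _ hcl 0 1
        fun i => (Ideal.ne_top_iff_one _).1 (hQ i).ne_top
      exact ⟨x, fun _ => ⟨fun h => absurd h hq, hx'⟩⟩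
  choose g hg using hstep
  let ι := (#T).ord.ToType
  obtain ⟨e⟩ : Nonempty (ι ≃ T × T) := by
    rw [← Cardinal.eq]
    simp [ι, Cardinal.mul_eq_self hT.le]
  let x : ι → T := (wellFounded_lt (α := ι)).fix
    fun a ih => g {t | ∃ b, ∃ h : b < a, ih b h = t} (e a)
  have hx : ∀ a, x a = g (x '' Set.Iio a) (e a) := by
    intro a
    have h1 : x a = g {t | ∃ b, ∃ _ : b < a, x b = t} (e a) := WellFounded.fix_eq _ _ _
    rw [h1]
    congr 1
    ext t
    simp
  have hsmall : ∀ a, #(x '' Set.Iio a) < #T := fun a =>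
    Cardinal.mk_image_le.trans_lt (by simpa [ι] using Cardinal.mk_Iio_lt a (by simp [ι]))
  have hprop := fun a => hg _ (e a) (hsmall a)
  simp only [← hx] at hprop
  let S : Finset ι → Subring T := fun F => Subring.closure (R₀ ∪ x '' F : Set T)
  have hS : ∀ F, IsAdequate Q p (S F) := by
    classical
    intro F
    induction F using Finset.induction_on_max with
    | empty => simpa [S] using hR₀
    | insert a F hlt ih =>
      have hle : S F ≤ Subring.closure (R₀ ∪ x '' Set.Iio a : Set T) :=
        Subring.closure_mono (Set.union_subset_union_right _ (Set.image_mono hlt))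
      have htr : ∀ i, ∀ f : (S F)[X], aeval (x a) f ∈ Q i →
          ∀ n, (f.coeff n : T) ∈ Q i := by
        intro i f hf n
        have h1 : aeval (x a) (f.map (Subring.inclusion hle)) = aeval (x a) f := by
          rw [aeval_def, eval₂_map, aeval_def]
          rfl
        have h2 := (hprop a).2 i (f.map (Subring.inclusion hle)) (h1 ▸ hf) n
        rw [coeff_map] at h2
        exact h2
      have heq : S (insert a F) = Subring.closure (insert (x a) (S F : Set T)) := by
        apply le_antisymm
        · refine Subring.closure_le.2 ?_
          rintro t (ht | ⟨b, hb, rfl⟩)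
          · exact Subring.subset_closure
              (Set.mem_insert_of_mem _ (Subring.subset_closure (Or.inl ht)))
          · rw [Finset.coe_insert] at hb
            rcases hb with rfl | hb
            · exact Subring.subset_closure (Set.mem_insert _ _)
            · exact Subring.subset_closure
                (Set.mem_insert_of_mem _ (Subring.subset_closure (Or.inr ⟨b, hb, rfl⟩)))
        · refine Subring.closure_le.2 (Set.insert_subset ?_ ?_)
          · exact Subring.subset_closure (Or.inr ⟨a, by simp, rfl⟩)
          · exact Subring.closure_mono (Set.union_subset_union_right _
              (Set.image_mono (by simp)))
      rw [heq]
      exact ih.closure_insert hp htr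
  have hdir : Directed (· ≤ ·) S := by
    classical
    refine directed_of_isDirected_le fun F G hFG => ?_
    exact Subring.closure_mono (Set.union_subset_union_right _ (Set.image_mono hFG))
  refine ⟨⨆ F, S F, ⟨(le_iSup S ∅) (hS ∅).1, fun r hr h0 => ?_⟩, fun u j hj => ?_⟩
  · obtain ⟨F, hF⟩ := (Subring.mem_iSup_of_directed hdir).1 hr
    obtain ⟨n, s, hs, hsQ, hrs⟩ := (hS F).2 r hF h0
    exact ⟨n, s, le_iSup S F hs, hsQ, hrs⟩
  · refine ⟨x (e.symm (u, j)), le_iSup S {e.symm (u, j)}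
      (Subring.subset_closure (Or.inr ⟨_, by simp, rfl⟩)), ?_⟩
    have := (hprop (e.symm (u, j))).1
    rw [e.apply_symm_apply] at this
    exact this hj

/-- Finitely generated ideals of an adequate, division closed, dense subring are contracted. -/
lemma IsAdequate.exists_sum_eq {T : Type u} [CommRing T] {k : ℕ} {Q : Fin k → Ideal T} {p : T}
    {A : Subring T} (hA : IsAdequate Q p A) (hp : p ∈ nonZeroDivisors T)
    (hreg : ∀ x : T, (∀ i, x ∉ Q i) → x ∈ nonZeroDivisors T)
    (hdiv : ∀ s t, s ∈ A → s ∈ nonZeroDivisors T → s * t ∈ A → t ∈ A)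
    (hdense : ∀ u j : T, (∀ i, j ∉ Q i) → ∃ x ∈ A, x - u ∈ Ideal.span {j})
    {ι : Type*} [Fintype ι] (N : ℕ) :
    ∀ (y t : ι → T) (i : ι) (s : T), (∀ l, y l ∈ A) → ∑ l, t l * y l ∈ A →
      y i = p ^ N * s → (∀ l, s ∉ Q l) →
      ∃ a : ι → T, (∀ l, a l ∈ A) ∧ ∑ l, t l * y l = ∑ l, a l * y l := by
  classical
  have hunit : ∀ (y t : ι → T) (i : ι), (∀ l, y l ∈ A) → ∑ l, t l * y l ∈ A →
      (∀ l, y i ∉ Q l) → ∃ a : ι → T, (∀ l, a l ∈ A) ∧ ∑ l, t l * y l = ∑ l, a l * y l := by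
    intro y t i hy hc hi
    choose a ha had using fun l => hdense (t l) (y i) hi
    choose d hd using fun l => Ideal.mem_span_singleton'.1 (had l)
    have hw : ∑ l, t l * y l - ∑ l, a l * y l = y i * -∑ l, d l * y l := by
      rw [← Finset.sum_sub_distrib, mul_neg, Finset.mul_sum, ← Finset.sum_neg_distrib]
      refine Finset.sum_congr rfl fun l _ => ?_
      linear_combination (-y l) * (hd l).symm
    have hwA : -∑ l, d l * y l ∈ A := by
      refine hdiv (y i) _ (hy i) (hreg _ hi) ?_
      rw [← hw]
      exact sub_mem hc (sum_mem fun l _ => mul_mem (ha l) (hy l))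
    refine ⟨fun l => a l + if l = i then -∑ l, d l * y l else 0, fun l => ?_, ?_⟩
    · refine add_mem (ha l) ?_
      split_ifs
      exacts [hwA, zero_mem _]
    · simp only [add_mul, Finset.sum_add_distrib, ite_mul, zero_mul, Finset.sum_ite_eq',
        Finset.mem_univ, if_true]
      linear_combination hw
  induction N with
  | zero =>
    intro y t i s hy hc hi hs
    exact hunit y t i hy hc (by simpa [hi] using hs)
  | succ N ih =>
    intro y t i s hy hc hi hs
    by_cases h : ∃ l, ∀ m, y l ∉ Q m
    · obtain ⟨l, hl⟩ := h
      exact hunit y t l hy hc hl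
    push Not at h
    choose m hm using h
    choose z hz hyz using fun l => hA.exists_eq_mul (hy l) (hm l)
    have hsum : ∀ b : ι → T, ∑ l, b l * y l = p * ∑ l, b l * z l := fun b => by
      rw [Finset.mul_sum]
      exact Finset.sum_congr rfl fun l _ => by rw [hyz l]; ring
    rw [hsum] at hc
    have hzi : z i = p ^ N * s := by
      refine (mul_cancel_left_mem_nonZeroDivisors hp).1 ?_
      rw [← hyz, hi]
      ring
    obtain ⟨a, ha, hat⟩ := ih z t i s hz (hdiv p _ hA.1 hp hc) hzi hs
    exact ⟨a, ha, by rw [hsum, hsum, hat]⟩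

lemma IsAdequate.comap_map_eq {T : Type u} [CommRing T] [IsNoetherianRing T]
    {k : ℕ} {Q : Fin k → Ideal T} {p : T}
    {A : Subring T} (hA : IsAdequate Q p A) (hp : p ∈ nonZeroDivisors T)
    (hreg : ∀ x : T, (∀ i, x ∉ Q i) → x ∈ nonZeroDivisors T)
    (hdiv : ∀ s t, s ∈ A → s ∈ nonZeroDivisors T → s * t ∈ A → t ∈ A)
    (hdense : ∀ u j : T, (∀ i, j ∉ Q i) → ∃ x ∈ A, x - u ∈ Ideal.span {j})
    (I : Ideal A) : (I.map A.subtype).comap A.subtype = I := by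
  refine le_antisymm (fun c hc => ?_) Ideal.le_comap_map
  obtain ⟨s, hs, hspan⟩ := (Submodule.fg_span_iff_fg_span_finset_subset
    (A.subtype '' I : Set T)).1 (IsNoetherian.noetherian (I.map A.subtype))
  have hc' : (c : T) ∈ Submodule.span T (Set.range ((↑) : s → T)) := by
    rw [Subtype.range_coe_subtype, Finset.setOfPred_mem, ← hspan]
    exact hc
  obtain ⟨t, ht⟩ := (Submodule.mem_span_range_iff_exists_fun T).1 hc'
  simp only [smul_eq_mul] at ht
  choose y hyI hy using fun l : s => hs l.2
  have hyA : ∀ l : s, (l : T) ∈ A := fun l => hy l ▸ (y l).2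
  by_cases h0 : ∀ l : s, (l : T) = 0
  · have : (c : T) = 0 := by
      rw [← ht]
      exact Finset.sum_eq_zero fun l _ => by rw [h0, mul_zero]
    rw [show c = 0 from Subtype.ext this]
    exact zero_mem _
  push Not at h0
  obtain ⟨i, hi⟩ := h0
  obtain ⟨N, w, -, hw, hiw⟩ := hA.2 _ (hyA i) hi
  obtain ⟨a, ha, hat⟩ := hA.exists_sum_eq hp hreg hdiv hdense N (fun l : s => (l : T)) t i w hyA
    (by rw [ht]; exact c.2) hiw hw
  have : c = ∑ l : s, (⟨a l, ha l⟩ : A) * y l := by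
    apply Subtype.ext
    rw [← ht, hat]
    simp only [AddSubmonoidClass.coe_finsetSum, Subring.coe_mul]
    exact Finset.sum_congr rfl fun l _ => by rw [← hy l]; rfl
  rw [this]
  exact sum_mem fun l _ => Ideal.mul_mem_left _ _ (hyI l)

/-- A dense subring carrying the subspace topology has the ambient ring as its completion. -/
lemma exists_adicCompletion_ringEquiv {T : Type u} [CommRing T] (M : Ideal T) [IsAdicComplete M T]
    (A : Subring T) (m : Ideal A) (hm : ∀ n, (M ^ n).comap A.subtype = m ^ n)
    (hdense : ∀ (n : ℕ) (t : T), ∃ a ∈ A, a - t ∈ M ^ n) :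
    ∃ φ : AdicCompletion m A ≃+* T,
      ∀ a : A, φ (algebraMap A (AdicCompletion m A) a) = (a : T) := by
  let f : (n : ℕ) → AdicCompletion m A →+* T ⧸ M ^ n := fun n =>
    (Ideal.quotientMap (M ^ n) A.subtype (hm n).ge).comp
      (AdicCompletion.evalₐ m n : AdicCompletion m A →+* A ⧸ m ^ n)
  have hfa : ∀ n x a, AdicCompletion.evalₐ m n x = Ideal.Quotient.mk _ a →
      f n x = Ideal.Quotient.mk _ (a : T) := by
    intro n x a h
    simp [f, h]
  have hf : ∀ {a b : ℕ} (hle : a ≤ b),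
      (Ideal.Quotient.factorPow M hle).comp (f b) = f a := by
    intro a b hle
    ext x
    obtain ⟨x, rfl⟩ := AdicCompletion.mk_surjective m A x
    rw [RingHom.comp_apply, hfa b _ _ (AdicCompletion.evalₐ_mk m b x),
      hfa a _ _ (AdicCompletion.evalₐ_mk m a x), Ideal.Quotient.factor_mk, Ideal.Quotient.eq]
    have h := AdicCompletion.Ideal.mk_eq_mk m hle x
    rw [Ideal.Quotient.eq, ← hm] at h
    simpa using h
  let φ := IsAdicComplete.liftRingHom M f hf
  have hφ : ∀ n x, Ideal.Quotient.mk (M ^ n) (φ x) = f n x := fun n x =>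
    IsAdicComplete.mk_liftRingHom M f hf n x
  have hinj : Function.Injective φ := by
    intro x y hxy
    refine AdicCompletion.ext_evalₐ fun n => ?_
    have h := (hφ n x).symm.trans ((congrArg _ hxy).trans (hφ n y))
    exact Ideal.quotientMap_injective' (H := (hm n).ge) (hm n).le h
  have hsurj : Function.Surjective φ := by
    intro t
    choose a ha hat using fun n => hdense n t
    have hcauchy : ∀ n, a n - a (n + 1) ∈ M ^ n := fun n => by
      have h := sub_mem (hat n) (Ideal.pow_le_pow_right n.le_succ (hat (n + 1)))
      simpa using h
    let s : AdicCompletion.AdicCauchySequence m A :=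
      AdicCompletion.AdicCauchySequence.mk m A (fun n => ⟨a n, ha n⟩) fun n => by
        rw [SModEq.sub_mem, smul_eq_mul, Ideal.mul_top, ← hm]
        exact hcauchy n
    refine ⟨AdicCompletion.mk m A s, ?_⟩
    rw [← sub_eq_zero]
    refine eq_zero_of_forall_mem_pow M fun n => ?_
    rw [← Ideal.Quotient.eq, hφ, hfa n _ _ (AdicCompletion.evalₐ_mk m n s), Ideal.Quotient.eq]
    exact hat n
  refine ⟨RingEquiv.ofBijective φ ⟨hinj, hsurj⟩, fun a => ?_⟩
  change φ _ = _
  rw [← sub_eq_zero]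
  refine eq_zero_of_forall_mem_pow M fun n => ?_
  rw [← Ideal.Quotient.eq, hφ]
  exact hfa n _ a (AdicCompletion.evalₐ_of m n a)

lemma exists_eq_pow_mul_notMem_span {T : Type u} [CommRing T] [IsLocalRing T] [IsNoetherianRing T]
    {p : T} (hp : p ∈ IsLocalRing.maximalIdeal T) {t : T} (ht : t ≠ 0) :
    ∃ n : ℕ, ∃ s, t = p ^ n * s ∧ s ∉ Ideal.span {p} := by
  classical
  have hspan : Ideal.span {p} ≠ ⊤ := fun h =>
    (IsLocalRing.mem_maximalIdeal p).1 hp (Ideal.span_singleton_eq_top.1 h)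
  have hex : ∃ n, t ∉ Ideal.span {p} ^ n := by
    by_contra! h
    apply ht
    rw [← Ideal.mem_bot, ← Ideal.iInf_pow_eq_bot_of_isLocalRing _ hspan, Ideal.mem_iInf]
    exact h
  obtain ⟨n, hn⟩ : ∃ n, Nat.find hex = n + 1 :=
    Nat.exists_eq_succ_of_ne_zero fun h => Nat.find_spec hex (by simp [h])
  have hmem : t ∈ Ideal.span {p} ^ n := by
    by_contra h
    have := Nat.find_min' hex h
    omega
  have hnot : t ∉ Ideal.span {p} ^ (n + 1) := hn ▸ Nat.find_spec hex
  rw [Ideal.span_singleton_pow, Ideal.mem_span_singleton] at hmem hnot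
  obtain ⟨s, rfl⟩ := hmem
  refine ⟨n, s, rfl, fun hs => hnot ?_⟩
  rw [pow_succ]
  exact mul_dvd_mul_left _ (Ideal.mem_span_singleton.1 hs)

lemma mem_span_of_mul_mem_span {T : Type u} [CommRing T] [IsNoetherianRing T] {p : T}
    {k : ℕ} {Q : Fin k → Ideal T}
    (hAss : ∀ P ∈ associatedPrimes T (T ⧸ Ideal.span {p}), ∃ i, P ≤ Q i) (x t : T)
    (hx : ∀ i, x ∉ Q i) (hxt : x * t ∈ Ideal.span {p}) : t ∈ Ideal.span {p} := by
  by_contra h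
  have hmem : x ∈ ⋃ P ∈ associatedPrimes T (T ⧸ Ideal.span {p}), (P : Set T) := by
    rw [biUnion_associatedPrimes_eq_zero_divisors]
    refine ⟨Ideal.Quotient.mk _ t, fun h0 => h (Ideal.Quotient.eq_zero_iff_mem.1 h0), ?_⟩
    rw [Algebra.smul_def]
    exact Ideal.Quotient.eq_zero_iff_mem.2 hxt
  simp only [Set.mem_iUnion] at hmem
  obtain ⟨P, hP, hxP⟩ := hmem
  obtain ⟨i, hi⟩ := hAss P hP
  exact hx i (hi hxP)

/-- **Theorem 11, sufficiency.** If `P ∩ Π[p] = (0)` for all `P ∈ Ass T`, every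
`P' ∈ Ass(T/pT)` is contained in some `Qᵢ`, and `((Qᵢ \ pT)Π[p]) ∩ Π[p] = {0}` for all
`i`, then there is a local domain `A ⊆ T` with `p ∈ A`, `Â = T`, and `pA` a prime ideal
whose formal fiber is semilocal with maximal ideals exactly the elements of `C`. -/
theorem statement8
    {T : Type u} [CommRing T] [IsLocalRing T] [IsNoetherianRing T]
    [IsAdicComplete (IsLocalRing.maximalIdeal T) T]
    {k : ℕ} (hk : 0 < k) (Q : Fin k → Ideal T)
    (hQprime : ∀ i, (Q i).IsPrime)
    (hQnonmax : ∀ i, Q i ≠ IsLocalRing.maximalIdeal T)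
    (hQinc : ∀ i j, Q i ≤ Q j → Q i = Q j)
    (p : T) (hp0 : p ≠ 0) (hpQ : ∀ i, p ∈ Q i)
    (hPi2 : ∀ P ∈ associatedPrimes T T, ∀ x ∈ Subring.closure ({p} : Set T), x ∈ P → x = 0)
    (hAss : ∀ P ∈ associatedPrimes T (T ⧸ Ideal.span {p}), ∃ i, P ≤ Q i)
    (hPi1 : ∀ i : Fin k, ∀ t ∈ CompAvoid (Q i) p ((Subring.closure {p} : Subring T) : Set T),
      t ∈ Subring.closure ({p} : Set T) → t = 0) :
    ∃ A : Subring T, ∃ hpA : p ∈ A,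
      IsNoetherianRing ↥A ∧ IsDomain ↥A ∧ QuasilocalWithMaxIdeal A ∧
      (∃ φ : AdicCompletion ((IsLocalRing.maximalIdeal T).comap A.subtype) ↥A ≃+* T,
        ∀ a : ↥A,
          φ (algebraMap ↥A (AdicCompletion ((IsLocalRing.maximalIdeal T).comap A.subtype) ↥A) a)
            = (a : T)) ∧
      (Ideal.span {(⟨p, hpA⟩ : ↥A)}).IsPrime ∧
      (∀ i, (Q i).comap A.subtype = Ideal.span {(⟨p, hpA⟩ : ↥A)}) ∧
      (∀ Q' : Ideal T, Q'.IsPrime → Q'.comap A.subtype = Ideal.span {(⟨p, hpA⟩ : ↥A)} →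
        ∃ i, Q' ≤ Q i) := by
  let i₀ : Fin k := ⟨0, hk⟩
  have hle : ∀ i, Q i ≤ IsLocalRing.maximalIdeal T := fun i =>
    IsLocalRing.le_maximalIdeal (hQprime i).ne_top
  have hp : p ∈ nonZeroDivisors T := by
    by_contra h
    have hmem : p ∈ ⋃ P ∈ associatedPrimes T T, (P : Set T) := by
      rw [biUnion_associatedPrimes_eq_compl_nonZeroDivisors]
      exact h
    simp only [Set.mem_iUnion] at hmem
    obtain ⟨P, hP, hpP⟩ := hmem
    exact hp0 (hPi2 P hP p (Subring.subset_closure rfl) hpP)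
  have hpow : ∀ t : T, t ≠ 0 → ∃ n : ℕ, ∃ s, t = p ^ n * s ∧ s ∉ Ideal.span {p} :=
    fun t => exists_eq_pow_mul_notMem_span (hle i₀ (hpQ i₀))
  have hreg := mem_span_of_mul_mem_span hAss
  have hreg' : ∀ x : T, (∀ i, x ∉ Q i) → x ∈ nonZeroDivisors T := fun x =>
    mem_nonZeroDivisors_of_notMem hp hreg hpow
  have hR₀ := isAdequate_divClosure_of_compAvoid (Q := Q) hp
    (Subring.subset_closure (Set.mem_singleton p)) hpow hPi1
  have hc : #(divClosure (Subring.closure {p})) ≤ ℵ₀ := by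
    have h : #(Subring.closure {p}) ≤ ℵ₀ := (mk_closure_le _).trans (by simp)
    exact (mk_divClosure_le _).trans
      ((mul_le_mul' h h).trans_eq Cardinal.aleph0_mul_aleph0)
  obtain ⟨y, hy, hyQ⟩ := exists_mem_forall_notMem hQprime
    (fun i => by simpa using not_pow_maximalIdeal_le (hQprime i) (hQnonmax i) 1)
  have hT : ℵ₀ < #T := by
    obtain ⟨σ, hσ⟩ := exists_family_sub_notMem hy
    exact (aleph0_lt_mk_nat_arrow (IsLocalRing.ResidueField T)).trans_le
      (Cardinal.mk_le_of_injective (f := σ) fun a b hab => hσ (Q i₀) (hQprime _) (hyQ _) a b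
        (by rw [hab, sub_self]; exact zero_mem _))
  obtain ⟨R, hR, hRdense⟩ := hR₀.exists_dense hk hQprime hQnonmax hp hc hT
  let A := divClosure R
  have hA : IsAdequate Q p A := hR.divClosure hp hreg hpow
  have hAdiv : ∀ s t, s ∈ A → s ∈ nonZeroDivisors T → s * t ∈ A → t ∈ A :=
    fun s t hs hs' hst => mem_divClosure_of_mul_mem hs hs' hst
  have hAdense : ∀ u j : T, (∀ i, j ∉ Q i) → ∃ x ∈ A, x - u ∈ Ideal.span {j} := by
    intro u j hj
    obtain ⟨x, hx, hxu⟩ := hRdense u j hj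
    exact ⟨x, le_divClosure R hx, hxu⟩
  have hAreg : ∀ a ∈ A, a ≠ 0 → a ∈ nonZeroDivisors T := fun a ha h0 =>
    hA.mem_nonZeroDivisors hp hreg' ha h0
  have hcontr := hA.comap_map_eq hp hreg' hAdiv hAdense
  have hApow : ∀ (n : ℕ) (t : T), ∃ a ∈ A, a - t ∈ IsLocalRing.maximalIdeal T ^ n := by
    intro n t
    obtain ⟨j, hj, hjQ⟩ := exists_mem_forall_notMem hQprime
      (fun i => not_pow_maximalIdeal_le (hQprime i) (hQnonmax i) n)
    obtain ⟨a, ha, hat⟩ := hAdense t j hjQ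
    exact ⟨a, ha, (Ideal.span_singleton_le_iff_mem _).2 hj hat⟩
  have hmap : ((IsLocalRing.maximalIdeal T).comap A.subtype).map A.subtype
      = IsLocalRing.maximalIdeal T := by
    refine le_antisymm Ideal.map_comap_le ?_
    refine Submodule.le_of_le_smul_of_le_jacobson_bot (I := IsLocalRing.maximalIdeal T)
      (IsNoetherian.noetherian _) (IsLocalRing.jacobson_eq_maximalIdeal ⊥ bot_ne_top).ge ?_
    intro u hu
    obtain ⟨a, ha, hau⟩ := hApow 2 u
    rw [pow_two] at hau
    have ham : a ∈ IsLocalRing.maximalIdeal T := by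
      have := add_mem (Ideal.mul_le_right hau) hu
      simpa using this
    have h1 : a ∈ ((IsLocalRing.maximalIdeal T).comap A.subtype).map A.subtype :=
      Ideal.mem_map_of_mem A.subtype (x := ⟨a, ha⟩) ham
    have := Submodule.add_mem_sup h1 (neg_mem hau)
    simpa using this
  have hQA : ∀ i, (Q i).comap A.subtype = Ideal.span {(⟨p, hA.1⟩ : A)} := by
    intro i
    refine le_antisymm (fun c hc => ?_) ?_
    · obtain ⟨d, hd, hcd⟩ := hA.exists_eq_mul c.2 hc
      exact Ideal.mem_span_singleton.2 ⟨⟨d, hd⟩, Subtype.ext hcd⟩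
    · rw [Ideal.span_singleton_le_iff_mem]
      exact hpQ i
  refine ⟨A, hA.1, ?_, ?_, ?_, ?_, ?_, hQA, ?_⟩
  · have hmono : StrictMono (Ideal.map A.subtype) :=
      Monotone.strictMono_of_injective (fun _ _ h => Ideal.map_mono h)
        (Function.LeftInverse.injective hcontr)
    have := hmono.wellFoundedGT
    exact isNoetherian_iff'.2 this
  · have : NoZeroDivisors A := ⟨fun {a b} hab => by
      by_contra! h
      have h1 := hAreg a a.2 (by simpa using h.1)
      have h2 : (a : T) * b = 0 := congrArg Subtype.val hab
      exact h.2 (Subtype.ext ((mem_nonZeroDivisors_iff_left.1 h1) _ h2))⟩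
    exact NoZeroDivisors.to_isDomain A
  · intro a ha
    rw [IsLocalRing.mem_maximalIdeal, mem_nonunits_iff, not_not] at ha
    obtain ⟨b, hb⟩ := ha.exists_right_inv
    exact IsUnit.of_mul_eq_one ⟨b, hAdiv a b a.2 ha.mem_nonZeroDivisors (hb ▸ one_mem A)⟩
      (Subtype.ext hb)
  · refine exists_adicCompletion_ringEquiv (IsLocalRing.maximalIdeal T) A _ (fun n => ?_) hApow
    rw [← hcontr (_ ^ n), Ideal.map_pow, hmap]
  · rw [← hQA i₀]
    exact (hQprime i₀).comap _
  · intro Q' hQ' hQ'A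
    by_contra! h
    obtain ⟨j, hj, hjQ⟩ := exists_mem_forall_notMem hQprime h
    obtain ⟨a, ha, haj⟩ := hAdense j (j * y) fun i hi =>
      ((hQprime i).mem_or_mem hi).elim (hjQ i) (hyQ i)
    obtain ⟨d, hd⟩ := Ideal.mem_span_singleton'.1 haj
    have haj' : a = j * (1 + d * y) := by linear_combination -hd
    have hunit : IsUnit (1 + d * y) := by
      by_contra hu
      have h1 : 1 + d * y ∈ IsLocalRing.maximalIdeal T := hu
      have h2 := sub_mem h1 (Ideal.mul_mem_left _ d hy)
      rw [add_sub_cancel_right] at h2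
      exact (Ideal.ne_top_iff_one _).1 (IsLocalRing.maximalIdeal.isMaximal T).ne_top h2
    have haQ' : (⟨a, ha⟩ : A) ∈ Q'.comap A.subtype := by
      change a ∈ Q'
      rw [haj']
      exact Ideal.mul_mem_right _ _ hj
    rw [hQ'A, ← hQA i₀] at haQ'
    have haQ : j * (1 + d * y) ∈ Q i₀ := haj' ▸ haQ'
    exact hjQ i₀ ((Ideal.mul_unit_mem_iff_mem _ hunit).1 haQ)
end
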